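/- Let ξ be a transcendental real number. Then ŵ_3(ξ) ≤ 3 + sqrt(2). -/

import Mathlib

open Polynomial Filter

/-- Height of an integer polynomial: the maximum absolute value of its coefficients. -/
noncomputable def polyHeight (P : Polynomial ℤ) : ℝ :=
  ((P.support.sup fun i => (P.coeff i).natAbs : ℕ) : ℝ)

/-- `P` and `Q` have no common non-constant factor in `ℤ[X]`. -/
def CoprimePoly (P Q : Polynomial ℤ) : Prop :=
  ∀ d : Polynomial ℤ, d ∣ P → d ∣ Q → d.natDegree = 0

/-- The exponent `w_n(ξ)`. -/
noncomputable def wExp (n : ℕ) (ξ : ℝ) : EReal :=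
  sSup {x : EReal | ∃ w : ℝ, x = (w : EReal) ∧
    {P : Polynomial ℤ | P.natDegree ≤ n ∧ 0 < |Polynomial.aeval ξ P| ∧
      |Polynomial.aeval ξ P| ≤ (polyHeight P) ^ (-w)}.Infinite}

/-- The uniform exponent `ŵ_n(ξ)`. -/
noncomputable def whExp (n : ℕ) (ξ : ℝ) : EReal :=
  sSup {x : EReal | ∃ w : ℝ, x = (w : EReal) ∧
    ∀ᶠ H : ℝ in atTop, ∃ P : Polynomial ℤ, P.natDegree ≤ n ∧ polyHeight P ≤ H ∧
      0 < |Polynomial.aeval ξ P| ∧ |Polynomial.aeval ξ P| ≤ H ^ (-w)}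

/-- The exponent `w*_n(ξ)` of approximation by algebraic numbers of degree at most `n`;
the height of an algebraic number is the height of its irreducible defining polynomial. -/
noncomputable def wStarExp (n : ℕ) (ξ : ℝ) : EReal :=
  sSup {x : EReal | ∃ w : ℝ, x = (w : EReal) ∧
    {α : ℝ | ∃ P : Polynomial ℤ, Irreducible P ∧ Polynomial.aeval α P = 0 ∧
      P.natDegree ≤ n ∧ 0 < |ξ - α| ∧ |ξ - α| ≤ (polyHeight P) ^ (-w - 1)}.Infinite}

/-- The uniform exponent `ŵ*_n(ξ)`. -/
noncomputable def whStarExp (n : ℕ) (ξ : ℝ) : EReal :=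
  sSup {x : EReal | ∃ w : ℝ, x = (w : EReal) ∧
    ∀ᶠ H : ℝ in atTop, ∃ α : ℝ, ∃ P : Polynomial ℤ, Irreducible P ∧
      Polynomial.aeval α P = 0 ∧ P.natDegree ≤ n ∧ polyHeight P ≤ H ∧
      0 < |ξ - α| ∧ |ξ - α| ≤ (polyHeight P)⁻¹ * H ^ (-w)}

/-- A Leibniz-type bound: one column of a real matrix has small entries. -/
theorem abs_det_le_of_column {ι : Type*} [Fintype ι] [DecidableEq ι] (N : Matrix ι ι ℝ) (i₀ : ι)
    (B : ι → ℝ) (T : ℝ) (hB : ∀ r, 0 < B r) (hN : ∀ r k, k ≠ i₀ → |N r k| ≤ B r)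
    (hT : ∀ r, |N r i₀| * ∏ k, B k ≤ T * B r) :
    |N.det| ≤ (Fintype.card ι).factorial * T := by
  rw [Matrix.det_apply]
  refine (Finset.abs_sum_le_sum_abs _ _).trans ?_
  have key : ∀ σ ∈ (Finset.univ : Finset (Equiv.Perm ι)),
      |Equiv.Perm.sign σ • ∏ i, N (σ i) i| ≤ T := by
    intro σ _
    have h1 : |Equiv.Perm.sign σ • ∏ i, N (σ i) i| = ∏ i, |N (σ i) i| := by
      rw [← Finset.abs_prod]
      rcases Int.units_eq_one_or (Equiv.Perm.sign σ) with h | h <;> simp [h]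
    rw [h1, ← Finset.mul_prod_erase _ _ (Finset.mem_univ i₀)]
    have h2 : ∏ i ∈ Finset.univ.erase i₀, |N (σ i) i| ≤ ∏ i ∈ Finset.univ.erase i₀, B (σ i) :=
      Finset.prod_le_prod (fun _ _ => abs_nonneg _)
        (fun i hi => hN _ _ (Finset.ne_of_mem_erase hi))
    have h3 : B (σ i₀) * ∏ i ∈ Finset.univ.erase i₀, B (σ i) = ∏ k, B k := by
      rw [Finset.mul_prod_erase _ (fun i => B (σ i)) (Finset.mem_univ i₀)]
      exact Equiv.prod_comp σ B
    have h4 := hT (σ i₀)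
    rw [← h3] at h4
    have h5 : |N (σ i₀) i₀| * ∏ i ∈ Finset.univ.erase i₀, B (σ i) ≤ T := by
      refine le_of_mul_le_mul_left ?_ (hB (σ i₀))
      linarith
    exact (mul_le_mul_of_nonneg_left h2 (abs_nonneg _)).trans h5
  refine (Finset.sum_le_card_nsmul _ _ _ key).trans ?_
  simp [Fintype.card_perm]

/-- The coefficient matrix of a finite family of integer polynomials. -/
def coeffMatrix {ι : Type*} (d : ι → ℕ) (p : ι → ℤ[X]) : Matrix ι ι ℤ :=
  Matrix.of fun r c => (p r).coeff (d c)

theorem det_updateCol_aeval {ι : Type*} [Fintype ι] [DecidableEq ι] (d : ι → ℕ) (M : Matrix ι ι ℝ)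
    (ξ : ℝ) (i₀ : ι) (h₀ : d i₀ = 0) :
    (M.updateCol i₀ fun r => ∑ c, ξ ^ d c * M r c).det = M.det := by
  have := Matrix.det_updateCol_sum M i₀ (fun c => ξ ^ d c)
  simpa [h₀] using this

theorem aeval_eq_sum_equiv {ι : Type*} [Fintype ι] {n : ℕ} (e : ι ≃ Fin n) (P : ℤ[X])
    (hP : P.natDegree < n) (ξ : ℝ) :
    ∑ c, ξ ^ (e c : ℕ) * ((P.coeff (e c) : ℤ) : ℝ) = aeval ξ P := by
  rw [aeval_eq_sum_range' hP, Finset.sum_range]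
  rw [← Equiv.sum_comp e]
  simp [mul_comm]

/-- The determinant of linearly independent integer polynomials is bounded by their heights and
values at a point. -/
theorem one_le_of_det_ne_zero {ι : Type*} [Fintype ι] [DecidableEq ι] {n : ℕ} (e : ι ≃ Fin n)
    (p : ι → ℤ[X]) (hp : ∀ i, (p i).natDegree < n) (ξ : ℝ) (i₀ : ι) (h₀ : (e i₀ : ℕ) = 0)
    (hdet : (coeffMatrix (fun c => (e c : ℕ)) p).det ≠ 0) (B : ι → ℝ) (T : ℝ)
    (hB : ∀ r, 0 < B r) (hpB : ∀ r k, |((p r).coeff k : ℝ)| ≤ B r)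
    (hT : ∀ r, |aeval ξ (p r)| * ∏ k, B k ≤ T * B r) :
    1 ≤ (Fintype.card ι).factorial * T := by
  set M := (coeffMatrix (fun c => (e c : ℕ)) p).map (Int.castRingHom ℝ) with hM
  have h1 : (1 : ℝ) ≤ |M.det| := by
    have : M.det = (((coeffMatrix (fun c => (e c : ℕ)) p).det : ℤ) : ℝ) := by
      rw [hM, ← RingHom.mapMatrix_apply, ← RingHom.map_det]; rfl
    rw [this]
    exact_mod_cast Int.one_le_abs hdet
  refine h1.trans ?_
  rw [← det_updateCol_aeval (fun c => (e c : ℕ)) M ξ i₀ h₀]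
  refine abs_det_le_of_column _ i₀ B T hB ?_ ?_
  · intro r k hk
    rw [Matrix.updateCol_ne hk]
    exact hpB r _
  · intro r
    rw [Matrix.updateCol_self]
    have : ∑ c, ξ ^ (e c : ℕ) * M r c = aeval ξ (p r) := aeval_eq_sum_equiv e (p r) (hp r) ξ
    rw [this]
    exact hT r

/-- The shifts of two polynomials, of degrees at most `m` and `3`, whose coefficients form the
Sylvester matrix. -/
noncomputable def sylRows (m : ℕ) (A Q : ℤ[X]) : Fin 3 ⊕ Fin m → ℤ[X] :=
  Sum.elim (fun i => X ^ (i : ℕ) * A) (fun i => X ^ (i : ℕ) * Q)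

theorem natDegree_sylRows_lt {m : ℕ} {A Q : ℤ[X]} (hA : A.natDegree ≤ m)
    (hQ : Q.natDegree ≤ 3) (i : Fin 3 ⊕ Fin m) : (sylRows m A Q i).natDegree < 3 + m := by
  rcases i with i | i
  · have := (natDegree_mul_le (p := (X : ℤ[X]) ^ (i : ℕ)) (q := A))
    rw [natDegree_X_pow] at this
    simp only [sylRows, Sum.elim_inl]
    omega
  · have := (natDegree_mul_le (p := (X : ℤ[X]) ^ (i : ℕ)) (q := Q))
    rw [natDegree_X_pow] at this
    simp only [sylRows, Sum.elim_inr]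
    omega

theorem natDegree_sum_C_mul_X_pow_lt {m : ℕ} (hm : 1 ≤ m) (v : Fin m → ℤ) :
    (∑ i : Fin m, C (v i) * X ^ (i : ℕ)).natDegree < m := by
  have : (∑ i : Fin m, C (v i) * X ^ (i : ℕ)).natDegree ≤ m - 1 :=
    natDegree_sum_le_of_forall_le _ _ fun i _ =>
      (natDegree_C_mul_X_pow_le _ _).trans (by omega)
  omega

theorem eq_zero_of_sum_C_mul_X_pow {m : ℕ} (v : Fin m → ℤ)
    (h : ∑ i : Fin m, C (v i) * (X : ℤ[X]) ^ (i : ℕ) = 0) (k : Fin m) : v k = 0 := by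
  have := congrArg (fun P : ℤ[X] => P.coeff k) h
  simpa [finsetSum_coeff, coeff_C_mul, coeff_X_pow, Fin.val_inj] using this

/-- The Sylvester matrix of an irreducible polynomial and a polynomial it does not divide is
nonsingular. -/
theorem det_sylRows_ne_zero {m : ℕ} (hm : 1 ≤ m) {A Q : ℤ[X]} (hirr : Irreducible A)
    (hA : A.natDegree = m) (hQ : Q.natDegree ≤ 3) (hAQ : ¬ A ∣ Q) :
    (coeffMatrix (fun c => (finSumFinEquiv c : ℕ)) (sylRows m A Q)).det ≠ 0 := by
  intro h
  obtain ⟨v, hv, hv0⟩ := Matrix.exists_vecMul_eq_zero_iff.mpr h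
  set U : ℤ[X] := ∑ i : Fin 3, C (v (Sum.inl i)) * X ^ (i : ℕ) with hU
  set V : ℤ[X] := ∑ i : Fin m, C (v (Sum.inr i)) * X ^ (i : ℕ) with hV
  have hUd : U.natDegree < 3 := natDegree_sum_C_mul_X_pow_lt (by norm_num) _
  have hVd : V.natDegree < m := natDegree_sum_C_mul_X_pow_lt hm _
  have hsum : U * A + V * Q = ∑ i, C (v i) * sylRows m A Q i := by
    rw [Fintype.sum_sum_type, hU, hV, Finset.sum_mul, Finset.sum_mul]
    simp [sylRows, mul_assoc]
  have hz : U * A + V * Q = 0 := by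
    ext k
    by_cases hk : k < 3 + m
    · rw [hsum]
      have := congrFun hv0 (finSumFinEquiv.symm ⟨k, hk⟩)
      simpa [Matrix.vecMul, dotProduct, coeffMatrix, finsetSum_coeff, coeff_C_mul] using this
    · rw [coeff_eq_zero_of_natDegree_lt, coeff_zero]
      refine lt_of_le_of_lt (natDegree_add_le _ _) ?_
      have h1 := natDegree_mul_le (p := U) (q := A)
      have h2 := natDegree_mul_le (p := V) (q := Q)
      omega
  have hprime : Prime A := hirr.prime
  have hdvd : A ∣ V * Q := ⟨-U, by linear_combination hz⟩
  have hV0 : V = 0 := by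
    by_contra hne
    have := natDegree_le_of_dvd ((hprime.dvd_or_dvd hdvd).resolve_right hAQ) hne
    omega
  have hU0 : U = 0 := by
    rw [hV0, zero_mul, add_zero] at hz
    exact (mul_eq_zero.mp hz).resolve_right hirr.ne_zero
  apply hv
  funext i
  rcases i with i | i
  · exact eq_zero_of_sum_C_mul_X_pow (fun i => v (Sum.inl i)) hU0 i
  · exact eq_zero_of_sum_C_mul_X_pow (fun i => v (Sum.inr i)) hV0 i

theorem abs_coeff_X_pow_mul_le {P : ℤ[X]} {b : ℝ} (hb : ∀ k, |(P.coeff k : ℝ)| ≤ b) (i k : ℕ) :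
    |((X ^ i * P).coeff k : ℝ)| ≤ b := by
  rw [coeff_X_pow_mul']
  split_ifs
  · exact hb _
  · simpa using (abs_nonneg _).trans (hb 0)

theorem abs_pow_le_one_add_pow (ξ : ℝ) {i n : ℕ} (h : i ≤ n) : |ξ ^ i| ≤ (1 + |ξ|) ^ n := by
  have h0 := abs_nonneg ξ
  rw [abs_pow]
  calc |ξ| ^ i ≤ (1 + |ξ|) ^ i := by gcongr; linarith
    _ ≤ (1 + |ξ|) ^ n := pow_le_pow_right₀ (by linarith) h

/-- The resultant estimate. -/
theorem one_le_resultant_bound {m : ℕ} (hm : 1 ≤ m) (hm3 : m ≤ 3) {A Q : ℤ[X]}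
    (hirr : Irreducible A)
    (hA : A.natDegree = m) (hQ : Q.natDegree ≤ 3) (hAQ : ¬ A ∣ Q) (ξ : ℝ) {a q : ℝ}
    (ha : 0 < a) (hq : 0 < q) (hAa : ∀ k, |(A.coeff k : ℝ)| ≤ a)
    (hQq : ∀ k, |(Q.coeff k : ℝ)| ≤ q) :
    1 ≤ 720 * (1 + |ξ|) ^ 3 * ((|aeval ξ A| / a + |aeval ξ Q| / q) * (a ^ 3 * q ^ m)) := by
  set K := (1 + |ξ|) ^ 3 with hK
  have hK0 : 0 ≤ K := by positivity
  have key := one_le_of_det_ne_zero (finSumFinEquiv (m := 3) (n := m)) (sylRows m A Q)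
    (natDegree_sylRows_lt hA.le hQ) ξ (Sum.inl 0) (by simp)
    (det_sylRows_ne_zero hm hirr hA hQ hAQ) (Sum.elim (fun _ => a) (fun _ => q))
    (K * ((|aeval ξ A| / a + |aeval ξ Q| / q) * (a ^ 3 * q ^ m)))
    (by rintro (r | r) <;> simpa) (by
      rintro (r | r) k
      · exact abs_coeff_X_pow_mul_le hAa _ _
      · exact abs_coeff_X_pow_mul_le hQq _ _) (by
      have hprod : ∏ k : Fin 3 ⊕ Fin m, Sum.elim (fun _ => a) (fun _ => q) k = a ^ 3 * q ^ m := by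
        simp
      rw [hprod]
      rintro (r | r)
      · simp only [sylRows, Sum.elim_inl, map_mul, map_pow, aeval_X, abs_mul]
        have h1 : |ξ ^ (r : ℕ)| ≤ K := abs_pow_le_one_add_pow ξ (by omega)
        have h2 : |aeval ξ A| ≤ (|aeval ξ A| / a + |aeval ξ Q| / q) * a := by
          rw [add_mul, div_mul_cancel₀ _ ha.ne']
          have : 0 ≤ |aeval ξ Q| / q * a := by positivity
          linarith
        calc _ ≤ K * ((|aeval ξ A| / a + |aeval ξ Q| / q) * a) * (a ^ 3 * q ^ m) := by gcongr
          _ = _ := by ring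
      · simp only [sylRows, Sum.elim_inr, map_mul, map_pow, aeval_X, abs_mul]
        have h1 : |ξ ^ (r : ℕ)| ≤ K := abs_pow_le_one_add_pow ξ (by omega)
        have h2 : |aeval ξ Q| ≤ (|aeval ξ A| / a + |aeval ξ Q| / q) * q := by
          rw [add_mul, div_mul_cancel₀ _ hq.ne']
          have : 0 ≤ |aeval ξ A| / a * q := by positivity
          linarith
        calc _ ≤ K * ((|aeval ξ A| / a + |aeval ξ Q| / q) * q) * (a ^ 3 * q ^ m) := by gcongr
          _ = _ := by ring)
  refine key.trans ?_
  have hf : (((Fintype.card (Fin 3 ⊕ Fin m)).factorial : ℕ) : ℝ) ≤ 720 := by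
    have : (Fintype.card (Fin 3 ⊕ Fin m)).factorial ≤ Nat.factorial 6 :=
      Nat.factorial_le (by simp; omega)
    exact_mod_cast this
  rw [mul_assoc 720 K]
  gcongr

/-- The image of an integer polynomial in `ℚ[X]`. -/
noncomputable abbrev toRat (P : ℤ[X]) : ℚ[X] := P.map (Int.castRingHom ℚ)

theorem toRat_injective : Function.Injective toRat :=
  map_injective _ (RingHom.injective_int _)

theorem dvd_of_toRat_eq_smul {F R : ℤ[X]} (hF : Irreducible F) (hF0 : 0 < F.natDegree) {x : ℚ}
    (h : toRat R = x • toRat F) : F ∣ R := by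
  have h1 : C (x.den : ℤ) * R = C x.num * F := by
    apply toRat_injective
    simp only [toRat, Polynomial.map_mul, Polynomial.map_C] at h ⊢
    rw [h, smul_eq_C_mul, ← mul_assoc, ← C_mul]
    congr 2
    simp
  have h2 : F ∣ C (x.den : ℤ) * R := ⟨C x.num, by rw [mul_comm F, ← h1]⟩
  rcases hF.prime.dvd_or_dvd h2 with h3 | h3
  · have h4 := natDegree_le_of_dvd h3 (by simp)
    rw [natDegree_C] at h4
    omega
  · exact h3

/-- A primitive polynomial `F` extends to a basis of the lattice of integer points on the rational
plane through `F` and `P`. -/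
theorem exists_plane_basis {F P : ℤ[X]} (hF : Irreducible F) (hF3 : F.natDegree = 3)
    (hP : P.natDegree ≤ 3) (hFP : ¬ F ∣ P) {x y : ℝ} (hx : ∀ k, |(F.coeff k : ℝ)| ≤ x)
    (hy : ∀ k, |(P.coeff k : ℝ)| ≤ y) :
    ∃ G : ℤ[X], G.natDegree ≤ 3 ∧ ¬ F ∣ G ∧ (∀ k, |(G.coeff k : ℝ)| ≤ x + y) ∧
      ∀ R : ℤ[X], toRat R ∈ Submodule.span ℚ {toRat F, toRat P} →
        ∃ α β : ℤ, R = C α * F + C β * G := by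
  have hlead : F.coeff 3 ≠ 0 := by
    rw [← hF3]; exact leadingCoeff_ne_zero.mpr hF.ne_zero
  obtain ⟨q, hq⟩ : ∃ q, F.coeff 3 * P.coeff q - F.coeff q * P.coeff 3 ≠ 0 := by
    by_contra! hcon
    have h1 : C (F.coeff 3) * P = C (P.coeff 3) * F := by
      ext k
      rw [coeff_C_mul, coeff_C_mul]
      linear_combination hcon k
    rcases hF.prime.dvd_or_dvd (⟨C (P.coeff 3), by rw [h1, mul_comm]⟩ : F ∣ C (F.coeff 3) * P)
      with h3 | h3
    · have h4 := natDegree_le_of_dvd h3 (by simpa using hlead)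
      rw [natDegree_C] at h4
      omega
    · exact hFP h3
  let δ : ℤ[X] →+ ℤ :=
    { toFun := fun v => F.coeff 3 * v.coeff q - F.coeff q * v.coeff 3
      map_zero' := by simp
      map_add' := fun a b => by simp only [coeff_add]; ring }
  have hδ : ∀ v, δ v = F.coeff 3 * v.coeff q - F.coeff q * v.coeff 3 := fun _ => rfl
  let Λ : AddSubgroup ℤ[X] := (Submodule.span ℚ {toRat F, toRat P}).toAddSubgroup.comap
    (mapRingHom (Int.castRingHom ℚ)).toAddMonoidHom
  have hΛ : ∀ v, v ∈ Λ ↔ toRat v ∈ Submodule.span ℚ {toRat F, toRat P} := fun _ => Iff.rfl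
  have hFΛ : F ∈ Λ := (hΛ F).mpr (Submodule.subset_span (by simp))
  have hPΛ : P ∈ Λ := (hΛ P).mpr (Submodule.subset_span (by simp))
  obtain ⟨g, hg⟩ := Int.subgroup_cyclic (Λ.map δ)
  obtain ⟨G₀, hG₀Λ, hG₀⟩ : g ∈ Λ.map δ := by
    rw [hg]; exact AddSubgroup.mem_closure_singleton_self g
  have hker : ∀ R ∈ Λ, δ R = 0 → ∃ α : ℤ, R = C α * F := by
    intro R hR hR0
    obtain ⟨s, t, hst⟩ := Submodule.mem_span_pair.mp ((hΛ R).mp hR)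
    have hcoeff : ∀ k, (R.coeff k : ℚ) = s * F.coeff k + t * P.coeff k := by
      intro k
      have := congrArg (fun p : ℚ[X] => p.coeff k) hst
      simpa using this.symm
    have ht : t = 0 := by
      have h1 : (F.coeff 3 : ℚ) * R.coeff q - F.coeff q * R.coeff 3 = 0 := by exact_mod_cast hR0
      have h2 : t * ((F.coeff 3 : ℚ) * P.coeff q - F.coeff q * P.coeff 3) = 0 := by
        rw [hcoeff, hcoeff] at h1
        linear_combination h1
      exact (mul_eq_zero.mp h2).resolve_right (by exact_mod_cast hq)
    obtain ⟨h, rfl⟩ := dvd_of_toRat_eq_smul hF (by omega) (x := s) (by rw [← hst, ht]; simp)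
    refine ⟨h.coeff 0, ?_⟩
    by_cases hh : h = 0
    · simp [hh]
    have hdeg : (F * h).natDegree ≤ 3 := by
      rw [natDegree_le_iff_coeff_eq_zero]
      intro N hN
      have := hcoeff N
      rw [ht, coeff_eq_zero_of_natDegree_lt (show F.natDegree < N by omega)] at this
      simpa using this
    rw [natDegree_mul hF.ne_zero hh] at hdeg
    rw [mul_comm]
    congr 1
    exact eq_C_of_natDegree_eq_zero (by omega)
  have hbasis : ∀ R ∈ Λ, ∃ α β : ℤ, R = C α * F + C β * G₀ := by
    intro R hR
    have : δ R ∈ Λ.map δ := ⟨R, hR, rfl⟩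
    rw [hg, AddSubgroup.mem_closure_singleton] at this
    obtain ⟨n, hn⟩ := this
    obtain ⟨α, hα⟩ := hker (R - n • G₀) (Λ.sub_mem hR (Λ.zsmul_mem hG₀Λ n))
      (by rw [map_sub, map_zsmul, hG₀, hn, sub_self])
    refine ⟨α, n, ?_⟩
    rw [← hα]
    simp
  obtain ⟨u, m, hPum⟩ := hbasis P hPΛ
  have hm : m ≠ 0 := by
    rintro rfl
    exact hFP ⟨C u, by rw [hPum]; simp [mul_comm]⟩
  set G := G₀ + C (u / m) * F with hG
  have hPG : P = C (u % m) * F + C m * G := by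
    rw [hPum, hG, mul_add, ← mul_assoc, ← C_mul]
    have : C u = C (u % m) + C (m * (u / m)) := by rw [← C_add, Int.emod_add_mul_ediv]
    rw [this]; ring
  have hcoef : ∀ k, m * G.coeff k = P.coeff k - (u % m) * F.coeff k := by
    intro k
    have := congrArg (fun p : ℤ[X] => p.coeff k) hPG
    simp only [coeff_add, coeff_C_mul] at this
    linarith
  refine ⟨G, ?_, ?_, ?_, ?_⟩
  · rw [natDegree_le_iff_coeff_eq_zero]
    intro N hN
    have := hcoef N
    rw [coeff_eq_zero_of_natDegree_lt (show F.natDegree < N by omega),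
      coeff_eq_zero_of_natDegree_lt (show P.natDegree < N by omega)] at this
    simpa [hm] using this
  · intro hdvd
    apply hFP
    rw [hPG]
    exact dvd_add (Dvd.intro_left _ rfl) (hdvd.mul_left _)
  · intro k
    have h1 : (m : ℝ) * G.coeff k = P.coeff k - ((u % m : ℤ) : ℝ) * F.coeff k := by
      exact_mod_cast hcoef k
    have hm1 : (1 : ℝ) ≤ |(m : ℝ)| := by exact_mod_cast Int.one_le_abs hm
    have hr : |((u % m : ℤ) : ℝ)| ≤ |(m : ℝ)| := by
      have h2 := Int.emod_nonneg u hm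
      have h3 := Int.emod_lt_abs u hm
      rw [abs_of_nonneg (by exact_mod_cast h2)]
      exact_mod_cast h3.le
    have hx0 : 0 ≤ x := (abs_nonneg _).trans (hx 0)
    have hy0 : 0 ≤ y := (abs_nonneg _).trans (hy 0)
    have h4 : |(m : ℝ)| * |(G.coeff k : ℝ)| ≤ |(m : ℝ)| * (x + y) := by
      rw [← abs_mul, h1]
      calc _ ≤ |(P.coeff k : ℝ)| + |((u % m : ℤ) : ℝ) * F.coeff k| := abs_sub _ _
        _ ≤ y + |(m : ℝ)| * x := by
            rw [abs_mul]
            exact add_le_add (hy k) (mul_le_mul hr (hx k) (abs_nonneg _) (abs_nonneg _))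
        _ ≤ _ := by nlinarith
    exact le_of_mul_le_mul_left h4 (by linarith)
  · intro R hR
    obtain ⟨α, β, h⟩ := hbasis R ((hΛ R).mpr hR)
    refine ⟨α - β * (u / m), β, ?_⟩
    rw [h, hG]
    simp only [C_sub, C_mul]
    ring

/-- The coefficients of `F(ξ) G - G(ξ) F`. -/
noncomputable def wedgeCoeff (ξ : ℝ) (F G : ℤ[X]) (k : ℕ) : ℝ :=
  aeval ξ F * G.coeff k - aeval ξ G * F.coeff k

theorem wedgeCoeff_comb (ξ : ℝ) (F G : ℤ[X]) (α β γ δ : ℤ) (k : ℕ) :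
    wedgeCoeff ξ (C α * F + C β * G) (C γ * F + C δ * G) k =
      ((α * δ - β * γ : ℤ) : ℝ) * wedgeCoeff ξ F G k := by
  simp only [wedgeCoeff, map_add, map_mul, coeff_add, coeff_C_mul, aeval_C,
    eq_intCast (algebraMap ℤ ℝ)]
  push_cast
  ring

/-- Pairing the rows of the Sylvester matrix bounds the resultant by one `wedgeCoeff` factor. -/
theorem one_le_of_wedgeCoeff_le {F G : ℤ[X]} (hF : Irreducible F) (hF3 : F.natDegree = 3)
    (hG : G.natDegree ≤ 3) (hFG : ¬ F ∣ G) {ξ : ℝ} (hξ : aeval ξ F ≠ 0) {f g ω : ℝ}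
    (hf : 0 < f) (hg : 0 < g) (hω : 0 < ω)
    (hFf : ∀ k, |(F.coeff k : ℝ)| ≤ f) (hGg : ∀ k, |(G.coeff k : ℝ)| ≤ g)
    (hW : ∀ k, |wedgeCoeff ξ F G k| ≤ ω) :
    1 ≤ 2160 * (1 + |ξ|) ^ 3 * (ω * (f ^ 2 * g ^ 2)) := by
  set K := (1 + |ξ|) ^ 3 with hK
  have hK0 : 0 ≤ K := by positivity
  let e : Fin 3 ⊕ Fin 3 ≃ Fin 6 := finSumFinEquiv
  set Z := coeffMatrix (fun c => (e c : ℕ)) (sylRows 3 F G) with hZ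
  have hdet : Z.det ≠ 0 := det_sylRows_ne_zero (m := 3) (by norm_num) hF hF3 hG hFG
  set M := Z.map (Int.castRingHom ℝ) with hM
  have hMe : ∀ r c, M r c = ((sylRows 3 F G r).coeff (e c) : ℝ) := fun _ _ => rfl
  have h1 : (1 : ℝ) ≤ |M.det| := by
    have : M.det = ((Z.det : ℤ) : ℝ) := by
      rw [hM, ← RingHom.mapMatrix_apply, ← RingHom.map_det]; rfl
    rw [this]
    exact_mod_cast Int.one_le_abs hdet
  let i₀ : Fin 3 ⊕ Fin 3 := Sum.inl 0
  let col : Fin 3 → (Fin 3 ⊕ Fin 3 → ℝ) := fun i =>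
    Sum.elim (Pi.single i (ξ ^ (i : ℕ) * aeval ξ F)) (Pi.single i (ξ ^ (i : ℕ) * aeval ξ G))
  have hcol : (fun r => ∑ c, ξ ^ (e c : ℕ) * M r c) = col 0 + col 1 + col 2 := by
    funext r
    have : ∑ c, ξ ^ (e c : ℕ) * M r c = aeval ξ (sylRows 3 F G r) :=
      aeval_eq_sum_equiv e (sylRows 3 F G r) (natDegree_sylRows_lt hF3.le hG r) ξ
    rw [this]
    rcases r with r | r <;> fin_cases r <;> simp [col, sylRows]
  have hsplit : M.det = (M.updateCol i₀ (col 0)).det + (M.updateCol i₀ (col 1)).det +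
      (M.updateCol i₀ (col 2)).det := by
    rw [← det_updateCol_aeval (fun c => (e c : ℕ)) M ξ i₀ rfl, hcol,
      Matrix.det_updateCol_add, Matrix.det_updateCol_add]
  have hL : 0 < |aeval ξ F| := abs_pos.mpr hξ
  have hbound : ∀ i, |(M.updateCol i₀ (col i)).det| ≤ 720 * (K * (ω * (f ^ 2 * g ^ 2))) := by
    intro i
    set N := M.updateCol i₀ (col i) with hN
    have hne : (Sum.inr i : Fin 3 ⊕ Fin 3) ≠ Sum.inl i := by simp
    rw [← Matrix.det_updateRow_add_smul_self N hne (-(aeval ξ G / aeval ξ F))]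
    have := abs_det_le_of_column
      (N.updateRow (Sum.inr i) (N (Sum.inr i) + (-(aeval ξ G / aeval ξ F)) • N (Sum.inl i))) i₀
      (Function.update (Sum.elim (fun _ => f) (fun _ => g)) (Sum.inr i) (ω / |aeval ξ F|))
      (K * (ω * (f ^ 2 * g ^ 2))) ?_ ?_ ?_
    · simpa [Nat.factorial] using this
    · intro r
      by_cases hr : r = Sum.inr i
      · subst hr; simp only [Function.update_self]; positivity
      · rw [Function.update_of_ne hr]
        rcases r with r | r <;> simpa
    · intro r k hk
      by_cases hr : r = Sum.inr i
      · subst hr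
        rw [Matrix.updateRow_self, Function.update_self, le_div_iff₀ hL, ← abs_mul]
        simp only [Pi.add_apply, Pi.smul_apply, hN, Matrix.updateCol_ne hk, hMe, sylRows,
          Sum.elim_inl, Sum.elim_inr, coeff_X_pow_mul', smul_eq_mul]
        split_ifs with hik
        · have h2 := hW ((e k : ℕ) - i)
          rw [wedgeCoeff] at h2
          refine le_of_eq_of_le (congrArg _ ?_) h2
          field_simp
          ring
        · simpa using hω.le
      · rw [Matrix.updateRow_ne hr, Function.update_of_ne hr, hN, Matrix.updateCol_ne hk, hMe]
        rcases r with r | r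
        · exact abs_coeff_X_pow_mul_le hFf _ _
        · exact abs_coeff_X_pow_mul_le hGg _ _
    · have hprod : ∏ k : Fin 3 ⊕ Fin 3,
          Function.update (Sum.elim (fun _ => f) (fun _ => g)) (Sum.inr i) (ω / |aeval ξ F|) k =
            f ^ 3 * g ^ 2 * (ω / |aeval ξ F|) := by
        rw [Fintype.prod_sum_type]
        fin_cases i <;> simp [Fin.prod_univ_three, Function.update] <;> ring
      rw [hprod]
      intro r
      by_cases hr : r = Sum.inr i
      · subst hr
        rw [Matrix.updateRow_self, Function.update_self]
        have : (N (Sum.inr i) + (-(aeval ξ G / aeval ξ F)) • N (Sum.inl i)) i₀ = 0 := by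
          simp only [Pi.add_apply, Pi.smul_apply, hN, Matrix.updateCol_self, col, Sum.elim_inl,
            Sum.elim_inr, Pi.single_eq_same, smul_eq_mul]
          field_simp
          ring
        rw [this]
        simp only [abs_zero, zero_mul]
        positivity
      · rw [Matrix.updateRow_ne hr, Function.update_of_ne hr, hN, Matrix.updateCol_self]
        rcases r with r | r
        · by_cases hri : r = i
          · subst hri
            simp only [col, Sum.elim_inl, Pi.single_eq_same, abs_mul]
            have h2 : |ξ ^ (r : ℕ)| ≤ K := abs_pow_le_one_add_pow ξ (by omega)
            calc |ξ ^ (r : ℕ)| * |aeval ξ F| * (f ^ 3 * g ^ 2 * (ω / |aeval ξ F|))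
                = |ξ ^ (r : ℕ)| * (ω * (f ^ 2 * g ^ 2)) * f := by field_simp
              _ ≤ K * (ω * (f ^ 2 * g ^ 2)) * f := by gcongr
          · simp only [col, Sum.elim_inl, Pi.single_eq_of_ne hri, abs_zero, zero_mul]
            positivity
        · have hri : r ≠ i := fun h => hr (by rw [h])
          simp only [col, Sum.elim_inr, Pi.single_eq_of_ne hri, abs_zero, zero_mul]
          positivity
  have h0 := hbound 0
  have h2 := hbound 1
  have h3 := hbound 2
  rw [hsplit] at h1
  have := abs_add_three (M.updateCol i₀ (col 0)).det (M.updateCol i₀ (col 1)).det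
    (M.updateCol i₀ (col 2)).det
  linarith

/-- Two nonassociated irreducible polynomials on the plane through `F` and `P` which are both
small at `ξ` force `F` and `P` to be large. -/
theorem one_le_plane_bound {F P R S : ℤ[X]} (hF : Irreducible F) (hF3 : F.natDegree = 3)
    (hP : P.natDegree ≤ 3) (hFP : ¬ F ∣ P) {ξ : ℝ} (hξ : aeval ξ F ≠ 0) {x y ω : ℝ}
    (hx0 : 0 < x) (hy0 : 0 < y) (hω : 0 < ω)
    (hx : ∀ k, |(F.coeff k : ℝ)| ≤ x) (hy : ∀ k, |(P.coeff k : ℝ)| ≤ y)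
    (hR0 : R ≠ 0) (hS0 : S ≠ 0) (hRS : ∀ a b : ℤ, C a * R = C b * S → a = 0 ∧ b = 0)
    (hR : toRat R ∈ Submodule.span ℚ {toRat F, toRat P})
    (hS : toRat S ∈ Submodule.span ℚ {toRat F, toRat P})
    (hW : ∀ k, |wedgeCoeff ξ R S k| ≤ ω) :
    1 ≤ 2160 * (1 + |ξ|) ^ 3 * (ω * (x ^ 2 * (x + y) ^ 2)) := by
  obtain ⟨G, hG3, hFG, hGb, hbasis⟩ := exists_plane_basis hF hF3 hP hFP hx hy
  obtain ⟨α, β, rfl⟩ := hbasis R hR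
  obtain ⟨γ, δ, rfl⟩ := hbasis S hS
  have hdet : α * δ - β * γ ≠ 0 := by
    intro h0
    obtain ⟨hδ, hβ⟩ := hRS δ β (by
      have : C (α * δ) = C (β * γ) := by rw [sub_eq_zero.mp h0]
      simp only [C_mul] at this
      linear_combination F * this)
    obtain ⟨hγ, hα⟩ := hRS γ α (by
      have : C (α * δ) = C (β * γ) := by rw [sub_eq_zero.mp h0]
      simp only [C_mul] at this
      linear_combination -G * this)
    simp [hβ, hα] at hR0
  refine one_le_of_wedgeCoeff_le hF hF3 hG3 hFG hξ hx0 (by linarith) hω hx hGb fun k => ?_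
  refine le_trans ?_ (hW k)
  rw [wedgeCoeff_comb, abs_mul]
  exact le_mul_of_one_le_left (abs_nonneg _) (by exact_mod_cast Int.one_le_abs hdet)

/-- The Mahler measure of an integer polynomial. -/
noncomputable def intMahler (p : ℤ[X]) : ℝ := (p.map (Int.castRingHom ℂ)).mahlerMeasure

theorem intMahler_mul (p q : ℤ[X]) : intMahler (p * q) = intMahler p * intMahler q := by
  rw [intMahler, Polynomial.map_mul, mahlerMeasure_mul]; rfl

theorem one_le_intMahler {p : ℤ[X]} (hp : p ≠ 0) : 1 ≤ intMahler p :=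
  one_le_mahlerMeasure_of_ne_zero hp

theorem intMahler_le {p : ℤ[X]} (hp : p.natDegree ≤ 3) {b : ℝ}
    (hb : ∀ k, |(p.coeff k : ℝ)| ≤ b) : intMahler p ≤ 4 * b := by
  refine (mahlerMeasure_le_sum_norm_coeff _).trans ?_
  rw [sum_over_range' _ (by simp) 4 (by
    have := natDegree_map_le (f := Int.castRingHom ℂ) (p := p); omega)]
  have := Finset.sum_le_card_nsmul (Finset.range 4)
    (fun k => ‖(p.map (Int.castRingHom ℂ)).coeff k‖) b (by
      intro k _
      simpa using hb k)
  simpa using this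

theorem abs_coeff_le_intMahler {p : ℤ[X]} (hp : p.natDegree ≤ 3) (k : ℕ) :
    |(p.coeff k : ℝ)| ≤ 3 * intMahler p := by
  have h1 := norm_coeff_le_choose_mul_mahlerMeasure k (p.map (Int.castRingHom ℂ))
  have h2 : ‖(p.map (Int.castRingHom ℂ)).coeff k‖ = |(p.coeff k : ℝ)| := by simp
  rw [h2] at h1
  refine h1.trans ?_
  have h3 : ((p.map (Int.castRingHom ℂ)).natDegree.choose k : ℝ) ≤ 3 := by
    rw [natDegree_map_eq_of_injective (RingHom.injective_int _)]
    have h4 := Nat.choose_le_choose k hp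
    have h5 : Nat.choose 3 k ≤ 3 := by
      rcases Nat.lt_or_ge 3 k with h | h
      · simp [Nat.choose_eq_zero_of_lt h]
      · interval_cases k <;> decide
    exact_mod_cast h4.trans h5
  exact mul_le_mul_of_nonneg_right h3 (mahlerMeasure_nonneg _)

theorem scale_mul_pow_four (w : ℝ) (j : ℕ) :
    (2 : ℝ) ^ (-(w * j)) * (2 ^ j) ^ 4 = ((2 : ℝ) ^ (4 - w)) ^ j := by
  rw [← Real.rpow_natCast _ 4, ← Real.rpow_natCast 2 j, ← Real.rpow_mul (by norm_num),
    ← Real.rpow_add (by norm_num), ← Real.rpow_natCast _ j, ← Real.rpow_mul (by norm_num)]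
  congr 1
  push_cast
  ring

theorem tendsto_scale {w : ℝ} (hw : 4 < w) :
    Tendsto (fun j : ℕ => ((2 : ℝ) ^ (4 - w)) ^ j) atTop (nhds 0) :=
  tendsto_pow_atTop_nhds_zero_of_lt_one (by positivity)
    (Real.rpow_lt_one_of_one_lt_of_neg (by norm_num) (by linarith))

/-- A uniformly approximating sequence of polynomials of degree at most three. -/
structure ApproxSeq (ξ w : ℝ) (J : ℕ) (P : ℕ → ℤ[X]) : Prop where
  natDegree_le : ∀ j, J ≤ j → (P j).natDegree ≤ 3
  ne_zero : ∀ j, J ≤ j → P j ≠ 0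
  abs_coeff_le : ∀ j, J ≤ j → ∀ k, |((P j).coeff k : ℝ)| ≤ 2 ^ j
  abs_aeval_le : ∀ j, J ≤ j → |aeval ξ (P j)| ≤ (2 : ℝ) ^ (-(w * j))

/-- Linear and quadratic irreducible polynomials cannot be too small at `ξ`. -/
theorem exists_lower_bound_of_natDegree_le_two {ξ w : ℝ} (hw : 4 < w)
    (hξ : ∀ P : ℤ[X], P ≠ 0 → aeval ξ P ≠ 0) {J : ℕ} {P : ℕ → ℤ[X]} (hP : ApproxSeq ξ w J P) :
    ∃ c : ℝ, 0 < c ∧ c ≤ 1 ∧ ∀ A : ℤ[X], Irreducible A → 1 ≤ A.natDegree → A.natDegree ≤ 2 →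
      c ≤ |aeval ξ A| * intMahler A ^ 4 := by
  set K := 720 * (1 + |ξ|) ^ 3 with hK
  have hK0 : 0 < K := by positivity
  obtain ⟨J₁, hJ₁⟩ := eventually_atTop.mp
    ((tendsto_scale hw).eventually (gt_mem_nhds (show 0 < 1 / (2 * 24 ^ 3 * K) by positivity)))
  set J₂ := max J J₁ with hJ₂
  have hfin := finite_mahlerMeasure_le 2 ⟨4 * 2 ^ J₂, by positivity⟩
  obtain ⟨c₁, hc₁, hc₁'⟩ : ∃ c₁ : ℝ, 0 < c₁ ∧ ∀ A : ℤ[X], A ≠ 0 → A.natDegree ≤ 2 →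
      intMahler A ≤ 4 * 2 ^ J₂ → c₁ ≤ |aeval ξ A| := by
    set T := hfin.toFinset.filter (· ≠ 0) with hT
    have hmem : ∀ A : ℤ[X], A ≠ 0 → A.natDegree ≤ 2 → intMahler A ≤ 4 * 2 ^ J₂ → A ∈ T := by
      intro A hA hd hM
      simp only [hT, Finset.mem_filter, Set.Finite.mem_toFinset, Set.mem_ofPred_eq]
      exact ⟨⟨hd, hM⟩, hA⟩
    rcases T.eq_empty_or_nonempty with hTe | hTn
    · exact ⟨1, one_pos, fun A hA hd hM => by simpa [hTe] using hmem A hA hd hM⟩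
    · obtain ⟨B, hB, hmin⟩ := T.exists_min_image (fun A => |aeval ξ A|) hTn
      exact ⟨|aeval ξ B|, abs_pos.mpr (hξ B (Finset.mem_filter.mp hB).2),
        fun A hA hd hM => hmin A (hmem A hA hd hM)⟩
  refine ⟨min 1 (min c₁ (1 / (2 * 24 ^ 2 * K))), by positivity, min_le_left _ _, ?_⟩
  intro A hA hd1 hd2
  have hM1 := one_le_intMahler hA.ne_zero
  by_cases hM : intMahler A ≤ 4 * 2 ^ J₂
  · calc _ ≤ c₁ := (min_le_right _ _).trans (min_le_left _ _)
      _ ≤ |aeval ξ A| := hc₁' A hA.ne_zero hd2 hM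
      _ ≤ _ := le_mul_of_one_le_right (abs_nonneg _) (one_le_pow₀ hM1)
  · push Not at hM
    obtain ⟨j, hj1, hj2, hj3⟩ : ∃ j, J₂ ≤ j ∧ 4 * 2 ^ j < intMahler A ∧
        intMahler A ≤ 4 * 2 ^ (j + 1) := by
      have hex : ∃ n : ℕ, intMahler A ≤ 4 * 2 ^ n := by
        obtain ⟨n, hn⟩ := pow_unbounded_of_one_lt (intMahler A) (one_lt_two (α := ℝ))
        exact ⟨n, by have : (0 : ℝ) < 2 ^ n := by positivity
                     linarith⟩
      classical
      have hs := Nat.find_spec hex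
      have hlt : J₂ < Nat.find hex := by
        rw [Nat.lt_find_iff]
        intro m hm
        push Not
        refine lt_of_le_of_lt ?_ hM
        gcongr
        norm_num
      refine ⟨Nat.find hex - 1, by omega, ?_, ?_⟩
      · exact not_le.mp (Nat.find_min hex (by omega))
      · rwa [Nat.sub_add_cancel (by omega)]
    have hjJ : J ≤ j := (le_max_left _ _).trans hj1
    set t : ℝ := 2 ^ j with ht
    have ht1 : 1 ≤ t := one_le_pow₀ (by norm_num)
    have hdvd : ¬ A ∣ P j := by
      rintro ⟨h, hh⟩
      have h1 := intMahler_le (hP.natDegree_le j hjJ) (hP.abs_coeff_le j hjJ)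
      have h0 : h ≠ 0 := by
        rintro rfl
        exact hP.ne_zero j hjJ (by simpa using hh)
      rw [hh, intMahler_mul] at h1
      have h2 := one_le_intMahler h0
      nlinarith
    have hres := one_le_resultant_bound hd1 (by omega) hA rfl (hP.natDegree_le j hjJ) hdvd ξ
      (a := 24 * t) (q := t) (by positivity) (by positivity)
      (fun k => (abs_coeff_le_intMahler (by omega) k).trans (by rw [pow_succ] at hj3; linarith))
      (hP.abs_coeff_le j hjJ)
    have hval := hP.abs_aeval_le j hjJ
    have hsc := scale_mul_pow_four w j
    have hsm := hJ₁ j ((le_max_right _ _).trans hj1)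
    rw [← hsc, ← ht] at hsm
    set s := (2 : ℝ) ^ (-(w * j)) with hs
    have hs0 : 0 ≤ s := by positivity
    set L := |aeval ξ A| with hL
    have hL0 : 0 ≤ L := abs_nonneg _
    have h1 : (L / (24 * t) + |aeval ξ (P j)| / t) * ((24 * t) ^ 3 * t ^ A.natDegree) ≤
        24 ^ 2 * (L * t ^ 4) + 24 ^ 3 * (s * t ^ 4) := by
      calc _ ≤ (L / (24 * t) + s / t) * ((24 * t) ^ 3 * t ^ 2) := by gcongr
        _ = _ := by field_simp
    have h2 : 1 ≤ K * (24 ^ 2 * (L * t ^ 4) + 24 ^ 3 * (s * t ^ 4)) :=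
      hres.trans (mul_le_mul_of_nonneg_left h1 hK0.le)
    rw [lt_div_iff₀ (by positivity)] at hsm
    have h3 : 1 / (2 * 24 ^ 2 * K) ≤ L * t ^ 4 := by
      rw [div_le_iff₀ (by positivity)]
      linarith
    calc _ ≤ 1 / (2 * 24 ^ 2 * K) := (min_le_right _ _).trans (min_le_right _ _)
      _ ≤ L * t ^ 4 := h3
      _ ≤ _ := by gcongr; linarith

theorem one_le_of_natDegree_eq_zero {A : ℤ[X]} (hA : A ≠ 0) (hd : A.natDegree = 0) (ξ : ℝ) :
    1 ≤ |aeval ξ A| * intMahler A ^ 4 := by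
  have hM := one_le_pow₀ (n := 4) (one_le_intMahler hA)
  rw [eq_C_of_natDegree_eq_zero hd] at hA ⊢
  have h0 : A.coeff 0 ≠ 0 := by rintro h; simp [h] at hA
  have h1 : (1 : ℝ) ≤ |(A.coeff 0 : ℝ)| := by exact_mod_cast Int.one_le_abs h0
  rw [← eq_C_of_natDegree_eq_zero hd, eq_C_of_natDegree_eq_zero hd, aeval_C,
    ← eq_C_of_natDegree_eq_zero hd]
  exact one_le_mul_of_one_le_of_one_le (by simpa using h1) hM

theorem pow_natDegree_le_of_factors {ξ c : ℝ} (hc0 : 0 < c) (hc1 : c ≤ 1)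
    (hc : ∀ A : ℤ[X], Irreducible A → 1 ≤ A.natDegree → A.natDegree ≤ 2 →
      c ≤ |aeval ξ A| * intMahler A ^ 4) (A : ℤ[X]) (hA : A ≠ 0)
    (hfac : ∀ B, Irreducible B → B ∣ A → B.natDegree ≤ 2) :
    c ^ A.natDegree ≤ |aeval ξ A| * intMahler A ^ 4 := by
  induction A using WfDvdMonoid.induction_on_irreducible with
  | zero => exact absurd rfl hA
  | unit u hu =>
    rw [natDegree_eq_zero_of_isUnit hu, pow_zero]
    exact one_le_of_natDegree_eq_zero hA (natDegree_eq_zero_of_isUnit hu) ξ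
  | mul a i ha hi ih =>
    have ih' := ih ha fun B hB hd => hfac B hB (hd.mul_left _)
    have hi' : c ^ i.natDegree ≤ |aeval ξ i| * intMahler i ^ 4 := by
      rcases Nat.eq_zero_or_pos i.natDegree with h | h
      · rw [h, pow_zero]
        exact one_le_of_natDegree_eq_zero hi.ne_zero h ξ
      · exact (pow_le_of_le_one hc0.le hc1 h.ne').trans (hc i hi h (hfac i hi (dvd_mul_right _ _)))
    rw [natDegree_mul hi.ne_zero ha, pow_add, map_mul, abs_mul, intMahler_mul]
    calc _ ≤ (|aeval ξ i| * intMahler i ^ 4) * (|aeval ξ a| * intMahler a ^ 4) := by gcongr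
      _ = _ := by ring

/-- An approximating sequence of irreducible cubic polynomials with positive leading
coefficient. -/
structure CubicSeq (ξ w : ℝ) (J : ℕ) (Q : ℕ → ℤ[X]) : Prop extends ApproxSeq ξ w J Q where
  irreducible : ∀ j, J ≤ j → Irreducible (Q j)
  natDegree_eq : ∀ j, J ≤ j → (Q j).natDegree = 3
  leadingCoeff_pos : ∀ j, J ≤ j → 0 < (Q j).leadingCoeff

/-- The approximating polynomials may be replaced by irreducible cubic ones. -/
theorem ApproxSeq.exists_cubicSeq {ξ w : ℝ} (hw : 4 < w)
    (hξ : ∀ P : ℤ[X], P ≠ 0 → aeval ξ P ≠ 0) {J : ℕ} {P : ℕ → ℤ[X]} (hP : ApproxSeq ξ w J P) :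
    ∃ J' Q, CubicSeq ξ w J' Q := by
  obtain ⟨c, hc0, hc1, hc⟩ := exists_lower_bound_of_natDegree_le_two hw hξ hP
  obtain ⟨J₁, hJ₁⟩ := eventually_atTop.mp
    ((tendsto_scale hw).eventually (gt_mem_nhds (show 0 < c ^ 3 / 256 by positivity)))
  have key : ∀ j, ∃ A : ℤ[X], max J J₁ ≤ j → Irreducible A ∧ A.natDegree = 3 ∧
      0 < A.leadingCoeff ∧ (∀ k, |(A.coeff k : ℝ)| ≤ 2 ^ j) ∧
      |aeval ξ A| ≤ (2 : ℝ) ^ (-(w * j)) := by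
    intro j
    by_cases hj : max J J₁ ≤ j
    swap
    · exact ⟨0, fun h => absurd h hj⟩
    have hjJ : J ≤ j := (le_max_left _ _).trans hj
    have hP3 := hP.natDegree_le j hjJ
    obtain ⟨B, hB, hBd, hB3⟩ : ∃ B, Irreducible B ∧ B ∣ P j ∧ 2 < B.natDegree := by
      by_contra! hcon
      have h1 := pow_natDegree_le_of_factors hc0 hc1 hc (P j) (hP.ne_zero j hjJ) hcon
      have h2 : c ^ 3 ≤ c ^ (P j).natDegree := pow_le_pow_of_le_one hc0.le hc1 hP3
      have h3 := intMahler_le hP3 (hP.abs_coeff_le j hjJ)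
      have h4 := hJ₁ j ((le_max_right _ _).trans hj)
      rw [← scale_mul_pow_four] at h4
      have h5 : |aeval ξ (P j)| * intMahler (P j) ^ 4 ≤
          (2 : ℝ) ^ (-(w * j)) * (4 * 2 ^ j) ^ 4 := by
        have := (one_le_intMahler (hP.ne_zero j hjJ))
        gcongr
        exact hP.abs_aeval_le j hjJ
      rw [mul_pow] at h5
      linarith
    obtain ⟨h, hh⟩ := hBd
    have hne := hP.ne_zero j hjJ
    have hh0 : h ≠ 0 := by rintro rfl; exact hne (by simpa using hh)
    have hdeg : (P j).natDegree = B.natDegree + h.natDegree := by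
      rw [hh, natDegree_mul hB.ne_zero hh0]
    obtain ⟨b, rfl⟩ : ∃ b, h = C b := ⟨_, eq_C_of_natDegree_eq_zero (by omega)⟩
    have hb : (1 : ℝ) ≤ |(b : ℝ)| := by
      have : b ≠ 0 := by rintro rfl; simp at hh0
      exact_mod_cast Int.one_le_abs this
    have hBc : ∀ k, |(B.coeff k : ℝ)| ≤ 2 ^ j := by
      intro k
      refine le_trans ?_ (hP.abs_coeff_le j hjJ k)
      rw [hh, coeff_mul_C]
      push_cast
      rw [abs_mul]
      exact le_mul_of_one_le_right (abs_nonneg _) hb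
    have hBv : |aeval ξ B| ≤ (2 : ℝ) ^ (-(w * j)) := by
      refine le_trans ?_ (hP.abs_aeval_le j hjJ)
      rw [hh, map_mul, aeval_C, abs_mul]
      exact le_mul_of_one_le_right (abs_nonneg _) (by simpa using hb)
    rcases lt_or_gt_of_ne (leadingCoeff_ne_zero.mpr hB.ne_zero) with hl | hl
    · exact ⟨-B, fun _ => ⟨(Associated.refl B).neg_right.irreducible hB,
        by rw [natDegree_neg]; omega, by simpa using hl,
        by simpa using hBc, by simpa using hBv⟩⟩
    · exact ⟨B, fun _ => ⟨hB, by omega, hl, hBc, hBv⟩⟩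
  choose Q hQ using key
  exact ⟨max J J₁, Q,
    { natDegree_le := fun j hj => (hQ j hj).2.1.le
      ne_zero := fun j hj => (hQ j hj).1.ne_zero
      abs_coeff_le := fun j hj => (hQ j hj).2.2.2.1
      abs_aeval_le := fun j hj => (hQ j hj).2.2.2.2
      irreducible := fun j hj => (hQ j hj).1
      natDegree_eq := fun j hj => (hQ j hj).2.1
      leadingCoeff_pos := fun j hj => (hQ j hj).2.2.1 }⟩

theorem le_of_one_le_scale {C w : ℝ} {n p : ℕ} (hC : 0 < C)
    (h : 1 ≤ C * ((2 : ℝ) ^ (-(w * n)) * 2 ^ p)) : w * n ≤ p + Real.logb 2 C := by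
  have h1 := Real.logb_le_logb_of_le one_lt_two one_pos h
  rw [Real.logb_one, Real.logb_mul hC.ne' (by positivity), Real.logb_mul (by positivity)
    (by positivity), Real.logb_rpow (by norm_num) (by norm_num), Real.logb_pow,
    Real.logb_self_eq_one one_lt_two] at h1
  linarith

theorem scale_antitone {w : ℝ} (hw : 0 ≤ w) {m n : ℕ} (h : m ≤ n) :
    (2 : ℝ) ^ (-(w * n)) ≤ (2 : ℝ) ^ (-(w * m)) := by
  refine Real.rpow_le_rpow_of_exponent_le one_le_two (neg_le_neg ?_)
  gcongr

namespace CubicSeq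

variable {ξ w : ℝ} {J : ℕ} {Q : ℕ → ℤ[X]}

theorem eq_of_dvd (hQ : CubicSeq ξ w J Q) {i j : ℕ} (hi : J ≤ i) (hj : J ≤ j) (h : Q i ∣ Q j) :
    Q i = Q j := by
  obtain ⟨u, hu⟩ := (hQ.irreducible i hi).associated_of_dvd (hQ.irreducible j hj) h
  obtain ⟨b, hb, hbu⟩ := isUnit_iff.mp u.isUnit
  have h1 := hQ.leadingCoeff_pos i hi
  have h2 := hQ.leadingCoeff_pos j hj
  rw [← hu, ← hbu, leadingCoeff_mul, leadingCoeff_C] at h2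
  rcases Int.isUnit_iff.mp hb with rfl | rfl
  · rw [← hu, ← hbu]; simp
  · linarith

theorem eq_zero_of_C_mul_eq (hQ : CubicSeq ξ w J Q) {i j : ℕ} (hi : J ≤ i) (hj : J ≤ j)
    (hij : Q i ≠ Q j) (a b : ℤ) (h : C a * Q i = C b * Q j) : a = 0 ∧ b = 0 := by
  have hb : b = 0 := by
    by_contra hb
    rcases (hQ.irreducible i hi).prime.dvd_or_dvd (⟨C a, by rw [← h, mul_comm]⟩ : Q i ∣ C b * Q j)
      with h3 | h3
    · have h4 := natDegree_le_of_dvd h3 (by simpa using hb)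
      rw [natDegree_C, hQ.natDegree_eq i hi] at h4
      omega
    · exact hij (hQ.eq_of_dvd hi hj h3)
  subst hb
  simpa [hQ.ne_zero i hi] using h

/-- The sequence cannot stay constant for long. -/
theorem exists_const_bound (hQ : CubicSeq ξ w J Q) (hw : 3 < w)
    (hξ : ∀ P : ℤ[X], P ≠ 0 → aeval ξ P ≠ 0) :
    ∃ c : ℝ, ∀ j n, J ≤ j → j ≤ n → (∀ i, j ≤ i → i ≤ n → Q i = Q j) →
      (w - 3) * n ≤ 2 * j + c := by
  set K := 720 * (1 + |ξ|) ^ 3 with hK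
  have hK0 : 0 < K := by positivity
  refine ⟨Real.logb 2 (16 * K), fun j n hj hjn hconst => ?_⟩
  have hex : ∃ m, n ≤ m ∧ Q (m + 1) ≠ Q j := by
    by_contra! hcon
    have h0 : Tendsto (fun m : ℕ => (2 : ℝ) ^ (-(w * (m + 1 : ℕ)))) atTop (nhds 0) := by
      have h1 : Tendsto (fun m : ℕ => ((2 : ℝ) ^ (-w)) ^ (m + 1)) atTop (nhds 0) :=
        (tendsto_add_atTop_iff_nat 1).mpr (tendsto_pow_atTop_nhds_zero_of_lt_one (by positivity)
          (Real.rpow_lt_one_of_one_lt_of_neg (by norm_num) (by linarith)))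
      refine h1.congr fun m => ?_
      rw [← Real.rpow_natCast, ← Real.rpow_mul (by norm_num), neg_mul]
    have h2 : |aeval ξ (Q j)| ≤ 0 := by
      refine ge_of_tendsto h0 (eventually_atTop.mpr ⟨n, fun m hm => ?_⟩)
      rw [← hcon m hm]
      exact hQ.abs_aeval_le _ (by omega)
    exact hξ _ (hQ.ne_zero j hj) (abs_nonpos_iff.mp h2)
  classical
  obtain ⟨hm1, hm2⟩ := Nat.find_spec hex
  set m := Nat.find hex with hm
  have hQm : Q m = Q j := by
    rcases hm1.eq_or_lt with h | h
    · rw [← h]; exact hconst n hjn le_rfl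
    · have := Nat.find_min hex (m := m - 1) (by omega)
      push Not at this
      have h3 := this (by omega)
      rwa [Nat.sub_add_cancel (by omega)] at h3
  have hJm : J ≤ m := by omega
  have hval : |aeval ξ (Q j)| ≤ (2 : ℝ) ^ (-(w * m)) := by
    rw [← hQm]; exact hQ.abs_aeval_le m hJm
  have hval' : |aeval ξ (Q (m + 1))| ≤ (2 : ℝ) ^ (-(w * m)) :=
    (hQ.abs_aeval_le (m + 1) (by omega)).trans (scale_antitone (by linarith) (by omega))
  have hres := one_le_resultant_bound (by norm_num) le_rfl (hQ.irreducible j hj)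
    (hQ.natDegree_eq j hj) (hQ.natDegree_le (m + 1) (by omega))
    (fun hd => hm2 (hQ.eq_of_dvd hj (by omega) hd).symm) ξ (a := 2 ^ j) (q := 2 ^ (m + 1))
    (by positivity) (by positivity) (hQ.abs_coeff_le j hj) (hQ.abs_coeff_le (m + 1) (by omega))
  set s := (2 : ℝ) ^ (-(w * m)) with hs
  have hs0 : 0 < s := by positivity
  have hjm : (2 : ℝ) ^ j ≤ 2 ^ m := pow_le_pow_right₀ one_le_two (by omega)
  have key : (1 : ℝ) ≤ 16 * K * (s * 2 ^ (2 * j + 3 * m)) := by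
    calc (1 : ℝ) ≤ K * ((s / 2 ^ j + s / 2 ^ (m + 1)) * ((2 ^ j) ^ 3 * (2 ^ (m + 1)) ^ 3)) :=
          hres.trans (by gcongr)
      _ = K * s * (8 * (2 ^ j) ^ 2 * (2 ^ m) ^ 3 + 4 * 2 ^ j * (2 ^ j) ^ 2 * (2 ^ m) ^ 2) := by
          field_simp; ring
      _ ≤ K * s * (8 * (2 ^ j) ^ 2 * (2 ^ m) ^ 3 + 8 * 2 ^ m * (2 ^ j) ^ 2 * (2 ^ m) ^ 2) := by
          gcongr; norm_num
      _ = _ := by ring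
  have h := le_of_one_le_scale (by positivity) key
  push_cast at h
  have h5 : (w - 3) * n ≤ (w - 3) * m := by
    have : 0 < w - 3 := by linarith
    gcongr
  linarith

/-- Consecutive distinct polynomials on a plane spanned by two earlier ones. -/
theorem exists_plane_bound (hQ : CubicSeq ξ w J Q) (hw : 3 < w)
    (hξ : ∀ P : ℤ[X], P ≠ 0 → aeval ξ P ≠ 0) :
    ∃ c : ℝ, ∀ j a m, J ≤ j → j < a → Q a ≠ Q j → j ≤ m → Q m ≠ Q (m + 1) →
      toRat (Q m) ∈ Submodule.span ℚ {toRat (Q j), toRat (Q a)} →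
      toRat (Q (m + 1)) ∈ Submodule.span ℚ {toRat (Q j), toRat (Q a)} →
      (w - 1) * m ≤ 2 * (j + a) + c := by
  set K := 2160 * (1 + |ξ|) ^ 3 with hK
  have hK0 : 0 < K := by positivity
  refine ⟨Real.logb 2 (16 * K), fun j a m hj hja hne hjm hm hm1 hm2 => ?_⟩
  set s := (2 : ℝ) ^ (-(w * m)) with hs
  have hs0 : 0 < s := by positivity
  have hv1 : |aeval ξ (Q m)| ≤ s := hQ.abs_aeval_le m (by omega)
  have hv2 : |aeval ξ (Q (m + 1))| ≤ s :=
    (hQ.abs_aeval_le (m + 1) (by omega)).trans (scale_antitone (by linarith) (by omega))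
  have hres := one_le_plane_bound (hQ.irreducible j hj) (hQ.natDegree_eq j hj)
    (hQ.natDegree_le a (by omega)) (fun hd => hne (hQ.eq_of_dvd hj (by omega) hd).symm)
    (hξ _ (hQ.ne_zero j hj)) (x := 2 ^ j) (y := 2 ^ a) (ω := 4 * (s * 2 ^ m))
    (by positivity) (by positivity) (by positivity) (hQ.abs_coeff_le j hj)
    (hQ.abs_coeff_le a (by omega)) (hQ.ne_zero m (by omega)) (hQ.ne_zero (m + 1) (by omega))
    (hQ.eq_zero_of_C_mul_eq (by omega) (by omega) hm) hm1 hm2 (by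
      intro k
      have h1 := hQ.abs_coeff_le m (by omega) k
      have h2 := hQ.abs_coeff_le (m + 1) (by omega) k
      calc _ ≤ |aeval ξ (Q m) * (Q (m + 1)).coeff k| + |aeval ξ (Q (m + 1)) * (Q m).coeff k| :=
            abs_sub _ _
        _ ≤ s * 2 ^ (m + 1) + s * 2 ^ m := by
            rw [abs_mul, abs_mul]; gcongr
        _ ≤ 4 * (s * 2 ^ m) := by
            rw [pow_succ]
            have : 0 ≤ s * 2 ^ m := by positivity
            linarith)
  have hja' : (2 : ℝ) ^ j ≤ 2 ^ a := pow_le_pow_right₀ one_le_two (by omega)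
  have key : (1 : ℝ) ≤ 16 * K * (s * 2 ^ (2 * (j + a) + m)) := by
    calc (1 : ℝ) ≤ K * (4 * (s * 2 ^ m) * ((2 ^ j) ^ 2 * (2 ^ a + 2 ^ a) ^ 2)) :=
          hres.trans (by gcongr)
      _ = _ := by ring
  have h := le_of_one_le_scale (by positivity) key
  push_cast at h
  linarith

/-- The sequence cannot stay on a plane for long. -/
theorem exists_planar_bound (hQ : CubicSeq ξ w J Q) (hw : 3 < w)
    (hξ : ∀ P : ℤ[X], P ≠ 0 → aeval ξ P ≠ 0) :
    ∃ c : ℝ, ∀ j a n, J ≤ j → j < a → Q a ≠ Q j → a ≤ n →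
      (∀ i, j ≤ i → i ≤ n → toRat (Q i) ∈ Submodule.span ℚ {toRat (Q j), toRat (Q a)}) →
      (w - 3) * (w - 1) * n ≤ 4 * (j + a) + c := by
  obtain ⟨c₁, hc₁⟩ := hQ.exists_const_bound hw hξ
  obtain ⟨c₂, hc₂⟩ := hQ.exists_plane_bound hw hξ
  refine ⟨2 * c₂ + 2 * (w - 1) + (w - 1) * c₁, fun j a n hj hja hne han hpl => ?_⟩
  have hex : ∃ m, j ≤ m ∧ ∀ i, m ≤ i → i ≤ n → Q i = Q n :=
    ⟨n, by omega, fun i h1 h2 => by rw [le_antisymm h2 h1]⟩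
  classical
  obtain ⟨hm1, hm2⟩ := Nat.find_spec hex
  have hmin : ∀ m < Nat.find hex, _ := fun m hm => Nat.find_min hex hm
  have hmn : Nat.find hex ≤ n := Nat.find_min' hex
    ⟨by omega, fun i h1 h2 => by rw [le_antisymm h2 h1]⟩
  obtain ⟨m, hm⟩ : ∃ m, Nat.find hex = m + 1 := by
    refine Nat.exists_eq_succ_of_ne_zero fun h => hne ?_
    rw [hm2 a (by omega) han, hm2 j (by omega) (by omega)]
  have hjm : j ≤ m := by
    by_contra! h
    refine hne ?_
    rw [hm2 a (by omega) han, hm2 j (by omega) (by omega)]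
  rw [hm] at hm1 hm2 hmin hmn
  have hQm : Q m ≠ Q (m + 1) := by
    intro h
    refine hmin m (by omega) ⟨hjm, fun i h1 h2 => ?_⟩
    rcases h1.eq_or_lt with rfl | h3
    · rw [h]; exact hm2 _ le_rfl hmn
    · exact hm2 i h3 h2
  have hA := hc₁ (m + 1) n (by omega) hmn fun i h1 h2 => by
    rw [hm2 i h1 h2, hm2 (m + 1) le_rfl hmn]
  have hB := hc₂ j a m hj hja hne hjm hQm (hpl m hjm (by omega)) (hpl (m + 1) (by omega) hmn)
  push_cast at hA
  have := mul_le_mul_of_nonneg_left hA (show 0 ≤ w - 1 by linarith)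
  linarith

/-- The indices at which the sequence first leaves the line and then the plane it starts on. -/
theorem exists_next (hQ : CubicSeq ξ w J Q) (hw : 3 < w)
    (hξ : ∀ P : ℤ[X], P ≠ 0 → aeval ξ P ≠ 0) :
    ∃ (c : ℝ) (a b : ℕ → ℕ), ∀ j, J ≤ j → j < a j ∧ a j < b j ∧ Q (a j) ≠ Q j ∧
      (∀ i, j ≤ i → i < a j → Q i = Q j) ∧
      toRat (Q (b j)) ∉ Submodule.span ℚ {toRat (Q j), toRat (Q (a j))} ∧
      (∀ i, j ≤ i → i < b j →
        toRat (Q i) ∈ Submodule.span ℚ {toRat (Q j), toRat (Q (a j))}) ∧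
      (w - 3) * a j ≤ 2 * j + c ∧ (w - 3) * (w - 1) * b j ≤ 4 * (j + a j) + c := by
  obtain ⟨c₁, hc₁⟩ := hQ.exists_const_bound hw hξ
  obtain ⟨c₂, hc₂⟩ := hQ.exists_planar_bound hw hξ
  have hu : 0 < w - 3 := by linarith
  have hv : 0 < (w - 3) * (w - 1) := mul_pos hu (by linarith)
  have hunbdd : ∀ u : ℝ, 0 < u → ∀ B : ℝ, ∀ m : ℕ, ∃ n : ℕ, m ≤ n ∧ B < u * n := by
    intro u hu B m
    obtain ⟨n, hn⟩ := exists_nat_gt (B / u)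
    refine ⟨max m n, le_max_left _ _, ?_⟩
    rw [div_lt_iff₀' hu] at hn
    refine hn.trans_le ?_
    gcongr
    exact le_max_right _ _
  classical
  have key : ∀ j, ∃ a b : ℕ, J ≤ j → j < a ∧ a < b ∧ Q a ≠ Q j ∧
      (∀ i, j ≤ i → i < a → Q i = Q j) ∧
      toRat (Q b) ∉ Submodule.span ℚ {toRat (Q j), toRat (Q a)} ∧
      (∀ i, j ≤ i → i < b →
        toRat (Q i) ∈ Submodule.span ℚ {toRat (Q j), toRat (Q a)}) ∧
      (w - 3) * a ≤ 2 * j + max (c₁ + (w - 3)) (c₂ + (w - 3) * (w - 1)) ∧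
      (w - 3) * (w - 1) * b ≤ 4 * (j + a) + max (c₁ + (w - 3)) (c₂ + (w - 3) * (w - 1)) := by
    intro j
    by_cases hj : J ≤ j
    swap
    · exact ⟨0, 0, fun h => absurd h hj⟩
    have hexa : ∃ a, j < a ∧ Q a ≠ Q j := by
      by_contra! hcon
      obtain ⟨n, hn, hn'⟩ := hunbdd _ hu (2 * j + c₁) j
      refine absurd (hc₁ j n hj hn fun i h1 h2 => ?_) (by linarith)
      rcases h1.eq_or_lt with rfl | h3
      · rfl
      · exact hcon i h3
    obtain ⟨ha1, ha2⟩ := Nat.find_spec hexa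
    have hamin : ∀ i, j ≤ i → i < Nat.find hexa → Q i = Q j := by
      intro i h1 h2
      rcases h1.eq_or_lt with rfl | h3
      · rfl
      · by_contra h
        exact Nat.find_min hexa h2 ⟨h3, h⟩
    set a := Nat.find hexa
    have hspan : ∀ i, j ≤ i → i ≤ a →
        toRat (Q i) ∈ Submodule.span ℚ {toRat (Q j), toRat (Q a)} := by
      intro i h1 h2
      rcases h2.eq_or_lt with rfl | h3
      · exact Submodule.subset_span (by simp)
      · rw [hamin i h1 h3]
        exact Submodule.subset_span (by simp)
    have hexb : ∃ b, a < b ∧ toRat (Q b) ∉ Submodule.span ℚ {toRat (Q j), toRat (Q a)} := by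
      by_contra! hcon
      obtain ⟨n, hn, hn'⟩ := hunbdd _ hv (4 * (j + a) + c₂) a
      refine absurd (hc₂ j a n hj ha1 ha2 hn fun i h1 h2 => ?_) (by linarith)
      rcases le_or_gt i a with h3 | h3
      · exact hspan i h1 h3
      · exact hcon i h3
    obtain ⟨hb1, hb2⟩ := Nat.find_spec hexb
    have hbmin : ∀ i, j ≤ i → i < Nat.find hexb →
        toRat (Q i) ∈ Submodule.span ℚ {toRat (Q j), toRat (Q a)} := by
      intro i h1 h2
      rcases le_or_gt i a with h3 | h3
      · exact hspan i h1 h3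
      · by_contra h
        exact Nat.find_min hexb h2 ⟨h3, h⟩
    set b := Nat.find hexb
    refine ⟨a, b, fun _ => ⟨ha1, hb1, ha2, hamin, hb2, hbmin, ?_, ?_⟩⟩
    · have := hc₁ j (a - 1) hj (by omega) fun i h1 h2 => hamin i h1 (by omega)
      rw [Nat.cast_sub (by omega), Nat.cast_one] at this
      have h2 := le_max_left (c₁ + (w - 3)) (c₂ + (w - 3) * (w - 1))
      linarith
    · have := hc₂ j a (b - 1) hj ha1 ha2 (by omega) fun i h1 h2 => hbmin i h1 (by omega)
      rw [Nat.cast_sub (by omega), Nat.cast_one] at this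
      have h2 := le_max_right (c₁ + (w - 3)) (c₂ + (w - 3) * (w - 1))
      linarith
  choose a b hab using key
  exact ⟨_, a, b, hab⟩

end CubicSeq

theorem det_coeffMatrix_ne_zero_iff {n : ℕ} (p : Fin n → ℤ[X]) (hp : ∀ i, (p i).natDegree < n) :
    (coeffMatrix (fun c : Fin n => (c : ℕ)) p).det ≠ 0 ↔
      LinearIndependent ℚ fun i => toRat (p i) := by
  set M := (coeffMatrix (fun c : Fin n => (c : ℕ)) p).map (Int.castRingHom ℚ) with hM
  have hdet : M.det = ((coeffMatrix (fun c : Fin n => (c : ℕ)) p).det : ℚ) := by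
    rw [hM, ← RingHom.mapMatrix_apply, ← RingHom.map_det]; rfl
  have hcomb : ∀ g : Fin n → ℚ, Matrix.vecMul g M = 0 ↔ ∑ i, g i • toRat (p i) = 0 := by
    intro g
    constructor
    · intro h
      ext k
      by_cases hk : k < n
      · have := congrFun h ⟨k, hk⟩
        simpa [Matrix.vecMul, dotProduct, hM, coeffMatrix, finsetSum_coeff] using this
      · have : ∀ i, (p i).coeff k = 0 := fun i =>
          coeff_eq_zero_of_natDegree_lt ((hp i).trans_le (by omega))
        simp [finsetSum_coeff, this]
    · intro h
      funext c
      have := congrArg (fun P : ℚ[X] => P.coeff c) h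
      simpa [Matrix.vecMul, dotProduct, hM, coeffMatrix, finsetSum_coeff] using this
  rw [← Int.cast_ne_zero (α := ℚ), ← hdet, not_iff_comm, Fintype.not_linearIndependent_iff,
    ← Matrix.exists_vecMul_eq_zero_iff]
  refine exists_congr fun g => ?_
  rw [hcomb, and_comm, Function.ne_iff]
  rfl

/-- A determinant of four cubic polynomials is controlled by their heights and values. -/
theorem abs_det_le_of_aeval {M : Matrix (Fin 4) (Fin 4) ℝ} (ξ : ℝ) (B : Fin 4 → ℝ) (T : ℝ)
    (hB : ∀ r, 0 < B r) (hM : ∀ r k, |M r k| ≤ B r)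
    (hT : ∀ r, |∑ c : Fin 4, ξ ^ (c : ℕ) * M r c| * ∏ k, B k ≤ T * B r) : |M.det| ≤ 24 * T := by
  rw [← det_updateCol_aeval (fun c : Fin 4 => (c : ℕ)) M ξ 0 rfl]
  have := abs_det_le_of_column (M.updateCol 0 fun r => ∑ c : Fin 4, ξ ^ (c : ℕ) * M r c) 0 B T hB
    (fun r k hk => by rw [Matrix.updateCol_ne hk]; exact hM r k)
    (fun r => by rw [Matrix.updateCol_self]; exact hT r)
  simpa [Nat.factorial] using this

/-- A three-dimensional space of cubic polynomials misses some monomial. -/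
theorem exists_X_pow_notMem (S : Submodule ℚ ℚ[X]) [FiniteDimensional ℚ S]
    (hS : Module.finrank ℚ S ≤ 3) : ∃ k < 4, toRat (X ^ k) ∉ S := by
  by_contra! hcon
  have hdeg : ∀ i : Fin 4, ((fun i : Fin 4 => (X : ℤ[X]) ^ (i : ℕ)) i).natDegree < 4 := by
    intro i
    simp
  have hli := (det_coeffMatrix_ne_zero_iff _ hdeg).mp (by
    have : coeffMatrix (fun c : Fin 4 => (c : ℕ)) (fun i : Fin 4 => (X : ℤ[X]) ^ (i : ℕ)) = 1 := by
      ext i k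
      simp [coeffMatrix, coeff_X_pow, Matrix.one_apply, Fin.ext_iff, eq_comm]
    rw [this, Matrix.det_one]
    exact one_ne_zero)
  have h4 := finrank_span_eq_card hli
  have hle : Submodule.span ℚ (Set.range fun i : Fin 4 => toRat ((X : ℤ[X]) ^ (i : ℕ))) ≤ S := by
    rw [Submodule.span_le]
    rintro _ ⟨i, rfl⟩
    exact hcon i i.2
  have := Submodule.finrank_mono hle
  rw [h4, Fintype.card_fin] at this
  omega

namespace CubicSeq

variable {ξ w : ℝ} {J : ℕ} {Q : ℕ → ℤ[X]}

theorem linearIndependent_pair (hQ : CubicSeq ξ w J Q) {j a : ℕ} (hj : J ≤ j) (ha : J ≤ a)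
    (hne : Q a ≠ Q j) : LinearIndependent ℚ ![toRat (Q a), toRat (Q j)] := by
  have h0 : ∀ i, J ≤ i → toRat (Q i) ≠ 0 := fun i hi h =>
    hQ.ne_zero i hi (toRat_injective (by simpa using h))
  rw [LinearIndependent.pair_symm_iff, LinearIndependent.pair_iff' (h0 j hj)]
  intro x hx
  have hd := dvd_of_toRat_eq_smul (hQ.irreducible j hj) (by rw [hQ.natDegree_eq j hj]; norm_num)
    hx.symm
  exact hne (hQ.eq_of_dvd hj ha hd).symm

theorem linearIndependent_triple (hQ : CubicSeq ξ w J Q) {j a b : ℕ} (hj : J ≤ j) (ha : J ≤ a)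
    (hne : Q a ≠ Q j)
    (hb : toRat (Q b) ∉ Submodule.span ℚ {toRat (Q j), toRat (Q a)}) :
    LinearIndependent ℚ ![toRat (Q b), toRat (Q a), toRat (Q j)] := by
  refine linearIndependent_finCons.mpr ⟨hQ.linearIndependent_pair hj ha hne, ?_⟩
  rwa [Matrix.range_cons, Matrix.range_cons, Matrix.range_empty, Set.union_empty,
    Set.singleton_union, Set.pair_comm]

/-- Four independent polynomials of the sequence. -/
theorem scale_le_of_notMem (hQ : CubicSeq ξ w J Q) (hw : 3 < w) {i j a b : ℕ} (hi : J ≤ i)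
    (hij : i ≤ j) (hja : j ≤ a) (hab : a ≤ b)
    (hli : LinearIndependent ℚ ![toRat (Q b), toRat (Q a), toRat (Q j)])
    (hmem : toRat (Q i) ∉
      Submodule.span ℚ (Set.range ![toRat (Q b), toRat (Q a), toRat (Q j)])) :
    w * i ≤ j + a + b + Real.logb 2 24 := by
  have hli4 : LinearIndependent ℚ ![toRat (Q i), toRat (Q b), toRat (Q a), toRat (Q j)] :=
    linearIndependent_finCons.mpr ⟨hli, hmem⟩
  let f : Fin 4 → ℕ := ![i, b, a, j]
  have hf : ∀ r, i ≤ f r := by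
    intro r; fin_cases r <;> simp [f] <;> omega
  have hp : ∀ r, (Q (f r)).natDegree < 4 := fun r => by
    rw [hQ.natDegree_eq _ (hi.trans (hf r))]; norm_num
  have hdet := (det_coeffMatrix_ne_zero_iff (fun r => Q (f r)) hp).mpr (by
    convert hli4 using 1
    funext r; fin_cases r <;> rfl)
  set s := (2 : ℝ) ^ (-(w * i)) with hs
  have hs0 : 0 < s := by positivity
  have key := one_le_of_det_ne_zero (Equiv.refl (Fin 4)) (fun r => Q (f r)) hp ξ 0 rfl hdet
    (fun r => 2 ^ f r) (s * 2 ^ (j + a + b)) (fun r => by positivity)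
    (fun r => hQ.abs_coeff_le _ (hi.trans (hf r))) (fun r => by
      have h1 : |aeval ξ (Q (f r))| ≤ s :=
        (hQ.abs_aeval_le _ (hi.trans (hf r))).trans (scale_antitone (by linarith) (hf r))
      have h2 : ∏ k, (2 : ℝ) ^ f k = 2 ^ i * 2 ^ (j + a + b) := by
        simp only [Fin.prod_univ_four, f, Matrix.cons_val]
        ring
      have h3 : (2 : ℝ) ^ i ≤ 2 ^ f r := pow_le_pow_right₀ one_le_two (hf r)
      rw [h2]
      calc _ ≤ s * (2 ^ f r * 2 ^ (j + a + b)) := by gcongr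
        _ = _ := by ring)
  have h := le_of_one_le_scale (w := w) (n := i) (p := j + a + b) (C := 24) (by norm_num)
    (by simpa [Nat.factorial] using key)
  push_cast at h
  exact h

/-- Three independent polynomials of the sequence lying in a fixed hyperplane. -/
theorem exists_scale_le_of_fixed (hQ : CubicSeq ξ w J Q) (hw : 3 < w)
    (hξ : ∀ P : ℤ[X], P ≠ 0 → aeval ξ P ≠ 0) (S : Submodule ℚ ℚ[X]) [FiniteDimensional ℚ S]
    (hS : Module.finrank ℚ S ≤ 3) {m : ℕ} (hm : J ≤ m) (hmS : toRat (Q m) ∈ S) :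
    ∃ c : ℝ, ∀ j a b, J ≤ j → j ≤ a → a ≤ b →
      LinearIndependent ℚ ![toRat (Q b), toRat (Q a), toRat (Q j)] →
      Submodule.span ℚ (Set.range ![toRat (Q b), toRat (Q a), toRat (Q j)]) = S →
      w * j ≤ a + b + c := by
  obtain ⟨k, hk, hkS⟩ := exists_X_pow_notMem S hS
  set θ := aeval ξ ((X : ℤ[X]) ^ k) / aeval ξ (Q m) with hθ
  set E : ℝ := 1 + |θ| * 2 ^ m with hE
  have hE0 : 0 < E := by positivity
  refine ⟨Real.logb 2 (24 * E), fun j a b hj hja hab hli hspan => ?_⟩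
  have hli4 : LinearIndependent ℚ
      ![toRat (X ^ k), toRat (Q b), toRat (Q a), toRat (Q j)] :=
    linearIndependent_finCons.mpr ⟨hli, by rw [hspan]; exact hkS⟩
  let p : ℤ[X] → Fin 4 → ℤ[X] := fun e => ![e, Q b, Q a, Q j]
  have hp : ∀ e : ℤ[X], e.natDegree < 4 → ∀ r, (p e r).natDegree < 4 := by
    intro e he r
    have := hQ.natDegree_le b (by omega)
    have := hQ.natDegree_le a (by omega)
    have := hQ.natDegree_le j (by omega)
    fin_cases r <;> simp [p] <;> omega
  have hXk : ((X : ℤ[X]) ^ k).natDegree < 4 := by simpa using hk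
  have hmd : (Q m).natDegree < 4 := by rw [hQ.natDegree_eq m hm]; norm_num
  have hdet := (det_coeffMatrix_ne_zero_iff (p (X ^ k)) (hp _ hXk)).mpr (by
    convert hli4 using 1
    funext r; fin_cases r <;> rfl)
  have hdet0 : (coeffMatrix (fun c : Fin 4 => (c : ℕ)) (p (Q m))).det = 0 := by
    by_contra hne
    have h1 := (det_coeffMatrix_ne_zero_iff (p (Q m)) (hp _ hmd)).mp hne
    have h2 : LinearIndependent ℚ ![toRat (Q m), toRat (Q b), toRat (Q a), toRat (Q j)] := by
      convert h1 using 1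
      funext r; fin_cases r <;> rfl
    exact (linearIndependent_finCons.mp h2).2 (by rw [hspan]; exact hmS)
  let N : ℤ[X] → Matrix (Fin 4) (Fin 4) ℝ := fun e =>
    (coeffMatrix (fun c : Fin 4 => (c : ℕ)) (p e)).map (Int.castRingHom ℝ)
  have hN : ∀ e, (N e).det = ((coeffMatrix (fun c : Fin 4 => (c : ℕ)) (p e)).det : ℝ) := by
    intro e
    simp only [N]
    rw [← RingHom.mapMatrix_apply, ← RingHom.map_det]; rfl
  have hNe : ∀ e r c, N e r c = ((p e r).coeff c : ℝ) := fun _ _ _ => rfl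
  set M := (N (X ^ k)).updateRow 0 (N (X ^ k) 0 + (-θ) • N (Q m) 0) with hM
  have hMdet : M.det = (N (X ^ k)).det := by
    have h1 : (N (X ^ k)).updateRow 0 (N (Q m) 0) = N (Q m) := by
      ext r c
      fin_cases r <;> simp [N, coeffMatrix, p, Matrix.updateRow_apply]
    rw [hM, Matrix.det_updateRow_add, Matrix.det_updateRow_smul, Matrix.updateRow_eq_self, h1,
      hN (Q m), hdet0]
    simp
  have h1 : (1 : ℝ) ≤ |M.det| := by
    rw [hMdet, hN]
    exact_mod_cast Int.one_le_abs hdet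
  set s := (2 : ℝ) ^ (-(w * j)) with hs
  have hs0 : 0 < s := by positivity
  have hMr : ∀ r, r ≠ 0 → M r = N (X ^ k) r := fun r hr => by rw [hM, Matrix.updateRow_ne hr]
  have hM0 : ∀ c, M 0 c = ((X ^ k : ℤ[X]).coeff c : ℝ) - θ * (Q m).coeff c := by
    intro c
    rw [hM, Matrix.updateRow_self]
    simp only [Pi.add_apply, Pi.smul_apply, hNe, p, Matrix.cons_val_zero, smul_eq_mul]
    ring
  let f : Fin 4 → ℕ := ![0, b, a, j]
  have hfr : ∀ r, r ≠ 0 → j ≤ f r ∧ p (X ^ k) r = Q (f r) := by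
    intro r hr
    fin_cases r <;> simp_all [f, p]; omega
  have key := abs_det_le_of_aeval (M := M) ξ ![E, 2 ^ b, 2 ^ a, 2 ^ j]
    (E * (s * 2 ^ (a + b))) ?_ ?_ ?_
  · have h := le_of_one_le_scale (w := w) (n := j) (p := a + b) (C := 24 * E) (by positivity)
      (by linarith)
    push_cast at h
    exact h
  · intro r; fin_cases r <;> simp; positivity
  · intro r c
    by_cases hr : r = 0
    · subst hr
      rw [hM0, Matrix.cons_val_zero]
      have h2 : |((X ^ k : ℤ[X]).coeff c : ℝ)| ≤ 1 := by
        rw [coeff_X_pow]; split_ifs <;> simp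
      have h3 := hQ.abs_coeff_le m hm c
      calc _ ≤ |((X ^ k : ℤ[X]).coeff c : ℝ)| + |θ * (Q m).coeff c| := abs_sub _ _
        _ ≤ E := by rw [abs_mul, hE]; gcongr
    · have hB : ![E, 2 ^ b, 2 ^ a, 2 ^ j] r = (2 : ℝ) ^ f r := by
        fin_cases r <;> simp_all [f]
      rw [hB, hMr r hr, hNe, (hfr r hr).2]
      exact hQ.abs_coeff_le _ (hj.trans (hfr r hr).1) _
  · intro r
    have hprod : ∏ r, ![E, 2 ^ b, 2 ^ a, 2 ^ j] r = E * 2 ^ j * 2 ^ (a + b) := by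
      simp only [Fin.prod_univ_four, Matrix.cons_val]
      ring
    rw [hprod]
    have heval : ∀ P : ℤ[X], P.natDegree < 4 →
        ∑ c : Fin 4, ξ ^ (c : ℕ) * ((P.coeff c : ℤ) : ℝ) = aeval ξ P := fun P hP =>
      aeval_eq_sum_equiv (Equiv.refl (Fin 4)) P hP ξ
    by_cases hr : r = 0
    · subst hr
      have : ∑ c : Fin 4, ξ ^ (c : ℕ) * M 0 c = 0 := by
        simp only [hM0, mul_sub, Finset.sum_sub_distrib, heval _ hXk]
        have h4 : ∑ c : Fin 4, ξ ^ (c : ℕ) * (θ * ((Q m).coeff c : ℝ)) = θ * aeval ξ (Q m) := by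
          rw [← heval _ hmd, Finset.mul_sum]
          exact Finset.sum_congr rfl fun c _ => by ring
        rw [h4, hθ, div_mul_cancel₀ _ (hξ _ (hQ.ne_zero m hm)), sub_self]
      rw [this, abs_zero, zero_mul, Matrix.cons_val_zero]
      positivity
    · have hB : ![E, 2 ^ b, 2 ^ a, 2 ^ j] r = (2 : ℝ) ^ f r := by
        fin_cases r <;> simp_all [f]
      have hfj := (hfr r hr).1
      have : ∑ c : Fin 4, ξ ^ (c : ℕ) * M r c = aeval ξ (Q (f r)) := by
        rw [← heval _ (lt_of_le_of_lt (hQ.natDegree_le _ (hj.trans hfj)) (by norm_num)),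
          ← (hfr r hr).2, hMr r hr]
        rfl
      have h5 : |aeval ξ (Q (f r))| ≤ s :=
        (hQ.abs_aeval_le _ (hj.trans hfj)).trans (scale_antitone (by linarith) hfj)
      have h6 : (2 : ℝ) ^ j ≤ 2 ^ f r := pow_le_pow_right₀ one_le_two hfj
      rw [this, hB]
      calc _ ≤ s * (E * 2 ^ f r * 2 ^ (a + b)) := by gcongr
        _ = _ := by ring

end CubicSeq

namespace CubicSeq

variable {ξ w : ℝ} {J : ℕ} {Q : ℕ → ℤ[X]}

/-- Infinitely often the three successive scales of the sequence satisfy a linear inequality. -/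
theorem exists_scale_le (hQ : CubicSeq ξ w J Q) (hw : 3 < w)
    (hξ : ∀ P : ℤ[X], P ≠ 0 → aeval ξ P ≠ 0) :
    ∃ c : ℝ, ∀ j₀ : ℕ, ∃ j a b : ℕ, j₀ ≤ j ∧ (w - 3) * a ≤ 2 * j + c ∧
      (w - 3) * (w - 1) * b ≤ 4 * (j + a) + c ∧ w * j ≤ j + a + b + c := by
  obtain ⟨c, a, b, hab⟩ := hQ.exists_next hw hξ
  let V : ℕ → Set ℚ[X] := fun j => Set.range ![toRat (Q (b j)), toRat (Q (a j)), toRat (Q j)]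
  let S : ℕ → Submodule ℚ ℚ[X] := fun j => Submodule.span ℚ (V j)
  have hfd : ∀ j, FiniteDimensional ℚ (S j) := fun j =>
    FiniteDimensional.span_of_finite ℚ (Set.finite_range _)
  have hli : ∀ j, J ≤ j → LinearIndependent ℚ ![toRat (Q (b j)), toRat (Q (a j)), toRat (Q j)] :=
    fun j hj => hQ.linearIndependent_triple hj (hj.trans (hab j hj).1.le) (hab j hj).2.2.1
      (hab j hj).2.2.2.2.1
  have hrank : ∀ j, J ≤ j → Module.finrank ℚ (S j) = 3 := fun j hj => by
    simpa using finrank_span_eq_card (hli j hj)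
  have hpl : ∀ j, Submodule.span ℚ {toRat (Q j), toRat (Q (a j))} ≤ S j := fun j => by
    refine Submodule.span_mono ?_
    rintro _ (rfl | rfl)
    · exact ⟨2, rfl⟩
    · exact ⟨1, rfl⟩
  have hSmem : ∀ j, J ≤ j → ∀ i, j ≤ i → i ≤ b j → toRat (Q i) ∈ S j := by
    intro j hj i h1 h2
    rcases h2.eq_or_lt with rfl | h3
    · exact Submodule.subset_span ⟨0, rfl⟩
    · exact hpl j ((hab j hj).2.2.2.2.2.1 i h1 h3)
  have hSle : ∀ j (T : Submodule ℚ ℚ[X]), toRat (Q j) ∈ T → toRat (Q (a j)) ∈ T →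
      toRat (Q (b j)) ∈ T → S j ≤ T := by
    intro j T h1 h2 h3
    rw [Submodule.span_le]
    rintro _ ⟨r, rfl⟩
    fin_cases r
    · exact h3
    · exact h2
    · exact h1
  by_cases hinf : ∀ j₀, ∃ j, j₀ ≤ j ∧ toRat (Q j) ∉ S (j + 1)
  · refine ⟨max c (w + Real.logb 2 24), fun j₀ => ?_⟩
    obtain ⟨j, hj, hjS⟩ := hinf (max j₀ J)
    have hjJ : J ≤ j := (le_max_right _ _).trans hj
    obtain ⟨h1, h2, -, -, -, -, h7, h8⟩ := hab (j + 1) (by omega)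
    have h := hQ.scale_le_of_notMem hw hjJ (Nat.le_succ j) h1.le h2.le (hli (j + 1) (by omega)) hjS
    have h9 := le_max_left c (w + Real.logb 2 24)
    have h10 := le_max_right c (w + Real.logb 2 24)
    refine ⟨j + 1, a (j + 1), b (j + 1), ((le_max_left _ _).trans hj).trans (Nat.le_succ j),
      h7.trans (by gcongr), h8.trans (by gcongr), ?_⟩
    push_cast at h ⊢
    linarith
  · push Not at hinf
    obtain ⟨j₀, hj₀⟩ := hinf
    set m := max j₀ J with hm
    have hmJ : J ≤ m := le_max_right _ _
    have hstep : ∀ j, m ≤ j → S j = S (j + 1) := by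
      intro j hj
      have hjJ : J ≤ j := hmJ.trans hj
      obtain ⟨h1, h2, h3, h4, -, h6, -⟩ := hab j hjJ
      obtain ⟨h1', h2', h3', -, -, -, -⟩ := hab (j + 1) (by omega)
      have hmem : ∀ i, j ≤ i → i ≤ b (j + 1) → toRat (Q i) ∈ S (j + 1) := by
        intro i hi hi'
        rcases hi.eq_or_lt with rfl | h
        · exact hj₀ j ((le_max_left _ _).trans hj)
        · exact hSmem (j + 1) (by omega) i h hi'
      have ha : a j ≤ b (j + 1) := by
        by_contra! h
        exact h3' (by rw [h4 _ (by omega) (by omega), h4 (j + 1) (by omega) (by omega)])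
      have hb : b j ≤ b (j + 1) := by
        by_contra! h
        have hle := hSle (j + 1) _ (h6 (j + 1) (by omega) (by omega))
          (h6 (a (j + 1)) (by omega) (by omega)) (h6 (b (j + 1)) (by omega) h)
        have : FiniteDimensional ℚ (Submodule.span ℚ {toRat (Q j), toRat (Q (a j))}) :=
          FiniteDimensional.span_of_finite ℚ (Set.toFinite _)
        have hr := Submodule.finrank_mono hle
        rw [hrank (j + 1) (by omega)] at hr
        have hr2 : Module.finrank ℚ (Submodule.span ℚ {toRat (Q j), toRat (Q (a j))}) ≤ 2 := by
          classical
          have := finrank_span_finset_le_card (R := ℚ) {toRat (Q j), toRat (Q (a j))}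
          rw [Finset.coe_pair] at this
          exact this.trans Finset.card_le_two
        omega
      refine Submodule.eq_of_le_of_finrank_eq (hSle j _ (hmem j le_rfl (by omega))
        (hmem _ h1.le ha) (hmem _ (by omega) hb)) ?_
      rw [hrank j hjJ, hrank (j + 1) (by omega)]
    have hconst : ∀ j, m ≤ j → S j = S m := by
      intro j hj
      induction j, hj using Nat.le_induction with
      | base => rfl
      | succ j hj ih => rw [← hstep j hj, ih]
    obtain ⟨c', hc'⟩ := hQ.exists_scale_le_of_fixed hw hξ (S m) (hrank m hmJ).le hmJ
      (hSmem m hmJ m le_rfl (by have := hab m hmJ; omega))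
    refine ⟨max c c', fun j₁ => ?_⟩
    have hj : m ≤ max j₁ m := le_max_right _ _
    set j := max j₁ m with hjdef
    obtain ⟨h1, h2, -, -, -, -, h7, h8⟩ := hab j (hmJ.trans hj)
    have h := hc' j (a j) (b j) (hmJ.trans hj) h1.le h2.le (hli j (hmJ.trans hj)) (hconst j hj)
    have h9 := le_max_right c c'
    have h10 : (0 : ℝ) ≤ j := Nat.cast_nonneg j
    exact ⟨j, a j, b j, le_max_left _ _, h7.trans (by gcongr; exact le_max_left _ _),
      h8.trans (by gcongr; exact le_max_left _ _), by linarith⟩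

theorem exponent_le (hQ : CubicSeq ξ w J Q) (hξ : ∀ P : ℤ[X], P ≠ 0 → aeval ξ P ≠ 0) :
    w ≤ 3 + Real.sqrt 2 := by
  by_contra! hlt
  set u := w - 3 with hu
  have hu0 : 0 < u := by have := Real.sqrt_nonneg 2; linarith
  have hu2 : 2 < u ^ 2 := by
    have h1 := Real.sq_sqrt (zero_le_two (α := ℝ))
    have h2 : Real.sqrt 2 < u := by linarith
    nlinarith [Real.sqrt_nonneg 2]
  obtain ⟨c, hc⟩ := hQ.exists_scale_le (by linarith) hξ
  set D := u * (u + 2) * c + 4 * c + u * c + u ^ 2 * (u + 2) * c with hD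
  obtain ⟨j₀, hj₀⟩ := exists_nat_gt (D / ((u ^ 2 - 2) * (u + 2) ^ 2))
  obtain ⟨j, a, b, hj, h1, h2, h3⟩ := hc j₀
  have hpos : 0 < (u ^ 2 - 2) * (u + 2) ^ 2 := mul_pos (by linarith) (by positivity)
  rw [div_lt_iff₀ hpos] at hj₀
  have hjj : (j₀ : ℝ) * ((u ^ 2 - 2) * (u + 2) ^ 2) ≤ j * ((u ^ 2 - 2) * (u + 2) ^ 2) := by
    gcongr
  have hw : w = u + 3 := by rw [hu]; ring
  have hw1 : w - 1 = u + 2 := by rw [hu]; ring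
  rw [hw1] at h2
  rw [hw] at h3
  have e1 := mul_le_mul_of_nonneg_left h1 (show 0 ≤ u * (u + 2) + 4 by positivity)
  have e2 := mul_le_mul_of_nonneg_left h2 hu0.le
  have e3 := mul_le_mul_of_nonneg_left h3 (show 0 ≤ u ^ 2 * (u + 2) by positivity)
  linarith

end CubicSeq

theorem abs_coeff_le_polyHeight (P : ℤ[X]) (k : ℕ) : |(P.coeff k : ℝ)| ≤ polyHeight P := by
  by_cases hk : k ∈ P.support
  · rw [← Int.cast_abs, Int.abs_eq_natAbs, Int.cast_natCast, polyHeight, Nat.cast_le]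
    exact Finset.le_sup (f := fun i => (P.coeff i).natAbs) hk
  · rw [notMem_support_iff.mp hk, polyHeight]
    simp

theorem exists_approxSeq {ξ w : ℝ}
    (h : ∀ᶠ H : ℝ in atTop, ∃ P : ℤ[X], P.natDegree ≤ 3 ∧ polyHeight P ≤ H ∧
      0 < |aeval ξ P| ∧ |aeval ξ P| ≤ H ^ (-w)) :
    ∃ J P, ApproxSeq ξ w J P := by
  obtain ⟨J, hJ⟩ := eventually_atTop.mp
    ((tendsto_pow_atTop_atTop_of_one_lt (one_lt_two (α := ℝ))).eventually h)
  choose! P hP using hJ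
  refine ⟨J, P, ⟨fun j hj => (hP j hj).1, fun j hj h0 => ?_,
    fun j hj k => (abs_coeff_le_polyHeight _ k).trans (hP j hj).2.1, fun j hj => ?_⟩⟩
  · have := (hP j hj).2.2.1
    simp [h0] at this
  · refine (hP j hj).2.2.2.trans_eq ?_
    rw [← Real.rpow_natCast, ← Real.rpow_mul (by norm_num)]
    congr 1
    ring

theorem stmt6 (ξ : ℝ) (hξ : Transcendental ℚ ξ) :
    whExp 3 ξ ≤ ((3 + Real.sqrt 2 : ℝ) : EReal) := by
  have hξ' : ∀ P : ℤ[X], P ≠ 0 → aeval ξ P ≠ 0 := fun P hP h =>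
    hP (transcendental_iff.mp (hξ.restrictScalars (algebraMap ℤ ℚ).injective_int) P h)
  refine sSup_le ?_
  rintro _ ⟨w, rfl, hw⟩
  rw [EReal.coe_le_coe_iff]
  by_contra! hlt
  have hw4 : 4 < w := by
    have : (1 : ℝ) < Real.sqrt 2 := by
      rw [Real.lt_sqrt] <;> norm_num
    linarith
  obtain ⟨J, P, hP⟩ := exists_approxSeq hw
  obtain ⟨J', Q, hQ⟩ := hP.exists_cubicSeq hw4 hξ'
  exact absurd (hQ.exponent_le hξ') (not_le.mpr hlt)
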